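/- arXiv:1503.00105 — 2 statements merged into one kernel-verified Lean document; each statement's English description precedes it below -/
import Mathlib

section
/- Let d ≥ 4 and 0 < α < d. For every β > α − 1 + 2(d−α)/d and every constant C > 0, there exist an α-dimensional measure μ on ℝ^d and a real number R > 1 such that ∫_{S^{d−1}} |μ̂(Rω)|² dσ(ω) > C · c_α(μ) · μ(ℝ^d) · R^{−β}. (In other words, β_d(α) ≤ α − 1 + 2(d−α)/d, where β_d(α) is the supremum of exponents β for which the decay estimate holds uniformly over α-dimensional measures.) -/
open MeasureTheory Metric Filter Set
open scoped ENNReal InnerProductSpace Topology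

noncomputable def sphereMeasure (d : ℕ) : Measure (EuclideanSpace ℝ (Fin d)) :=
  (μH[(d : ℝ) - 1]).restrict (sphere (0 : EuclideanSpace ℝ (Fin d)) 1)

noncomputable def cAlpha (d : ℕ) (α : ℝ) (μ : Measure (EuclideanSpace ℝ (Fin d))) : ℝ≥0∞ :=
  ⨆ (x : EuclideanSpace ℝ (Fin d)) (r : ℝ) (_ : 0 < r), μ (ball x r) / ENNReal.ofReal (r ^ α)

def IsAlphaDimensional (d : ℕ) (α : ℝ) (μ : Measure (EuclideanSpace ℝ (Fin d))) : Prop :=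
  μ (closedBall 0 1)ᶜ = 0 ∧ cAlpha d α μ ≠ ⊤

noncomputable def fourierMeasure {d : ℕ} (μ : Measure (EuclideanSpace ℝ (Fin d)))
    (ξ : EuclideanSpace ℝ (Fin d)) : ℂ :=
  (((2 * Real.pi) ^ (-(d : ℝ) / 2) : ℝ) : ℂ) *
    ∫ x, Complex.exp (-Complex.I * ((⟪x, ξ⟫_ℝ : ℝ) : ℂ)) ∂μ


theorem hausdorffMeasure_unitSphere_lt_top (n : ℕ) :
    μH[(n : ℝ)] (sphere (0 : EuclideanSpace ℝ (Fin (n + 1))) 1) < ⊤ := by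
  classical
  let h : Fin (n + 1) → ℝ → (Fin n → ℝ) → EuclideanSpace ℝ (Fin (n + 1)) := fun i s u =>
    WithLp.toLp 2 (Fin.insertNth (α := fun _ => ℝ) i s u)
  let g : Fin (n + 1) → ℝ → (Fin n → ℝ) → EuclideanSpace ℝ (Fin (n + 1)) := fun i s u =>
    ‖h i s u‖⁻¹ • h i s u
  have hh : ∀ i s, ContDiff ℝ 1 (h i s) := fun i s => by
    rw [contDiff_euclidean]
    intro j
    rcases Fin.eq_self_or_eq_succAbove i j with rfl | ⟨k, rfl⟩
    · simpa [h] using contDiff_const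
    · simpa [h] using contDiff_apply ℝ ℝ k
  have hne : ∀ i s u, s ≠ 0 → h i s u ≠ 0 := fun i s u hs h0 => by
    apply hs
    have := congrArg (fun x : EuclideanSpace ℝ (Fin (n + 1)) => x i) h0
    simpa [h] using this
  have hg : ∀ i s, s ≠ 0 → ContDiff ℝ 1 (g i s) := fun i s hs =>
    (((hh i s).norm ℝ fun u => hne i s u hs).inv fun u => norm_ne_zero_iff.2 (hne i s u hs)).smul
      (hh i s)
  have hfin : ∀ i s, s ≠ 0 → μH[(n : ℝ)] (g i s '' closedBall 0 1) < ⊤ := fun i s hs => by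
    obtain ⟨K, hK⟩ := ((hg i s hs).locallyLipschitz.locallyLipschitzOn
      (s := closedBall 0 1)).exists_lipschitzOnWith_of_compact (isCompact_closedBall 0 1)
    refine (hK.hausdorffMeasure_image_le n.cast_nonneg).trans_lt ?_
    have hvol : (μH[(n : ℝ)] : Measure (Fin n → ℝ)) = volume := by
      simpa using hausdorffMeasure_pi_real (ι := Fin n)
    rw [hvol]
    exact ENNReal.mul_lt_top (by simp) measure_closedBall_lt_top
  have hsub : sphere (0 : EuclideanSpace ℝ (Fin (n + 1))) 1 ⊆
      ⋃ i : Fin (n + 1), (g i 1 '' closedBall 0 1 ∪ g i (-1) '' closedBall 0 1) := by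
    intro x hx
    have hx1 : ‖x‖ = 1 := by simpa using hx
    obtain ⟨i, -, hi⟩ := Finset.exists_max_image Finset.univ (fun i => |x i|) ⟨0, by simp⟩
    have hpos : 0 < |x i| := by
      by_contra! hcon
      have : x = 0 := by
        ext j
        exact abs_nonpos_iff.1 ((hi j (Finset.mem_univ j)).trans hcon)
      simp [this] at hx1
    have hmem : (fun j => x (i.succAbove j) / |x i|) ∈ closedBall (0 : Fin n → ℝ) 1 := by
      rw [mem_closedBall_zero_iff, pi_norm_le_iff_of_nonneg zero_le_one]
      intro j
      rw [Real.norm_eq_abs, abs_div, abs_abs]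
      exact (div_le_one hpos).2 (hi _ (Finset.mem_univ _))
    have key : ∀ s : ℝ, x i = s * |x i| →
        g i s (fun j => x (i.succAbove j) / |x i|) = x := fun s hs => by
      have h1 : h i s (fun j => x (i.succAbove j) / |x i|) = |x i|⁻¹ • x := by
        ext j
        rcases Fin.eq_self_or_eq_succAbove i j with rfl | ⟨k, rfl⟩
        · simp only [h, Fin.insertNth_apply_same, PiLp.smul_apply, smul_eq_mul]
          rw [eq_inv_mul_iff_mul_eq₀ hpos.ne', mul_comm, ← hs]
        · simp [h, div_eq_inv_mul]
      simp only [g, h1, norm_smul, hx1]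
      simp [smul_smul, hpos.ne']
    refine mem_iUnion.2 ⟨i, ?_⟩
    rcases le_total 0 (x i) with h0 | h0
    · exact Or.inl ⟨_, hmem, key 1 (by rw [abs_of_nonneg h0, one_mul])⟩
    · exact Or.inr ⟨_, hmem, key (-1) (by rw [abs_of_nonpos h0]; ring)⟩
  refine (measure_mono hsub).trans_lt ?_
  refine (measure_iUnion_fintype_le _ _).trans_lt (ENNReal.sum_lt_top.2 fun i _ => ?_)
  exact (measure_union_le _ _).trans_lt
    (ENNReal.add_lt_top.2 ⟨hfin i 1 one_ne_zero, hfin i (-1) (by norm_num)⟩)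

theorem le_hausdorffMeasure_sphere_inter_ball (n : ℕ) (hn : 1 ≤ n) {c : ℝ} (hc : 0 < c) (hc1 : c ≤ 1)
    {ω : EuclideanSpace ℝ (Fin (n + 1))} (hω : ‖ω‖ = 1) (hωc : c ≤ ω (Fin.last n))
    {ρ : ℝ} (hρ : 0 < ρ) (hρ1 : ρ ≤ 1) :
    ENNReal.ofReal ((c ^ 2 * ρ / (2 * n)) ^ n) ≤ μH[(n : ℝ)] (sphere 0 1 ∩ ball ω ρ) := by
  let p : EuclideanSpace ℝ (Fin (n + 1)) → (Fin n → ℝ) := fun x i => x i.castSucc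
  have hp : LipschitzWith 1 p := LipschitzWith.of_dist_le_mul fun x y => by
    rw [NNReal.coe_one, one_mul, dist_pi_le_iff dist_nonneg]
    intro i
    simpa [p, dist_eq_norm] using PiLp.norm_apply_le (x - y) i.castSucc
  have hvol : (μH[(n : ℝ)] : Measure (Fin n → ℝ)) = volume := by
    simpa using hausdorffMeasure_pi_real (ι := Fin n)
  have hn0 : (1 : ℝ) ≤ n := by exact_mod_cast hn
  set s : ℝ := c ^ 2 * ρ / (4 * n) with hs
  have hs0 : 0 < s := by positivity
  have hns : n * s = c ^ 2 * ρ / 4 := by rw [hs]; field_simp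
  have hc2 : c ^ 2 ≤ 1 := by nlinarith
  have hs1 : s ≤ 1 := by
    have : c ^ 2 * ρ ≤ 1 := by nlinarith
    nlinarith
  have hsumω : ∑ i : Fin n, ω i.castSucc ^ 2 + ω (Fin.last n) ^ 2 = 1 := by
    rw [← Fin.sum_univ_castSucc (fun i => ω i ^ 2), ← EuclideanSpace.real_norm_sq_eq, hω, one_pow]
  have hsub : ball (p ω) s ⊆ p '' (sphere 0 1 ∩ ball ω ρ) := by
    intro u hu
    have hu' : ∀ i, |u i - ω i.castSucc| < s := fun i => by
      simpa [p, Real.dist_eq] using (dist_pi_lt_iff hs0).1 hu i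
    have hω1 : ∀ i, |ω i| ≤ 1 := fun i => by
      simpa [hω] using PiLp.norm_apply_le ω i
    have hdiff : |∑ i, u i ^ 2 - ∑ i : Fin n, ω i.castSucc ^ 2| ≤ n * (3 * s) := by
      rw [← Finset.sum_sub_distrib]
      refine (Finset.abs_sum_le_sum_abs _ _).trans ?_
      refine (Finset.sum_le_card_nsmul _ _ (3 * s) fun i _ => ?_).trans (by simp)
      have e : u i ^ 2 - ω i.castSucc ^ 2 = (u i - ω i.castSucc) * (u i + ω i.castSucc) := by ring
      rw [e, abs_mul, mul_comm]
      have h1 := (hu' i).le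
      have h2 : |u i + ω i.castSucc| ≤ 3 := by
        have h3 := abs_le.1 h1
        have h4 := abs_le.1 (hω1 i.castSucc)
        rw [abs_le]; constructor <;> linarith
      exact mul_le_mul h2 h1 (abs_nonneg _) (by norm_num)
    have hd3 : n * (3 * s) = 3 / 4 * (c ^ 2 * ρ) := by linarith
    rw [hd3] at hdiff
    have hc2' : c ^ 2 ≤ ω (Fin.last n) ^ 2 := by gcongr
    have hlt : c ^ 2 * ρ ≤ c ^ 2 := by nlinarith [sq_nonneg c]
    have hnn : 0 ≤ 1 - ∑ i, u i ^ 2 := by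
      have := abs_le.1 hdiff
      nlinarith
    set t := Real.sqrt (1 - ∑ i, u i ^ 2) with ht
    have ht0 : 0 ≤ t := Real.sqrt_nonneg _
    have ht2 : t ^ 2 = 1 - ∑ i, u i ^ 2 := Real.sq_sqrt hnn
    have htd : |t - ω (Fin.last n)| * c ≤ 3 / 4 * (c ^ 2 * ρ) := by
      have e : (t - ω (Fin.last n)) * (t + ω (Fin.last n))
          = -(∑ i, u i ^ 2 - ∑ i : Fin n, ω i.castSucc ^ 2) := by
        linear_combination ht2 - hsumω
      have : |t - ω (Fin.last n)| * |t + ω (Fin.last n)| ≤ 3 / 4 * (c ^ 2 * ρ) := by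
        rw [← abs_mul, e, abs_neg]; exact hdiff
      refine le_trans ?_ this
      gcongr
      exact (by linarith : c ≤ t + ω (Fin.last n)).trans (le_abs_self _)
    have htd' : |t - ω (Fin.last n)| ≤ 3 / 4 * ρ := by
      have : |t - ω (Fin.last n)| * c ≤ (3 / 4 * (c * ρ)) * c := by linarith
      have := le_of_mul_le_mul_right this hc
      nlinarith
    refine ⟨WithLp.toLp 2 (Fin.snoc (α := fun _ => ℝ) u t), ⟨?_, ?_⟩, ?_⟩
    · rw [mem_sphere_zero_iff_norm, ← sq_eq_sq₀ (norm_nonneg _) zero_le_one,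
        EuclideanSpace.real_norm_sq_eq, Fin.sum_univ_castSucc]
      simp [ht2]
    · rw [mem_ball, dist_eq_norm, ← sq_lt_sq₀ (norm_nonneg _) hρ.le,
        EuclideanSpace.real_norm_sq_eq, Fin.sum_univ_castSucc]
      simp only [PiLp.sub_apply, Fin.snoc_castSucc, Fin.snoc_last]
      have h1 : ∑ i : Fin n, (u i - ω i.castSucc) ^ 2 ≤ n * s ^ 2 := by
        refine (Finset.sum_le_card_nsmul _ _ (s ^ 2) fun i _ => ?_).trans (by simp)
        exact sq_le_sq' (by linarith [(abs_lt.1 (hu' i)).1]) (abs_lt.1 (hu' i)).2.le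
      have h2 : (t - ω (Fin.last n)) ^ 2 ≤ (3 / 4 * ρ) ^ 2 := by
        rw [← sq_abs]; gcongr
      have hsρ : s ≤ ρ / 4 := by
        have : s ≤ n * s := by nlinarith
        nlinarith
      have h3 : n * s ^ 2 ≤ ρ / 4 * (ρ / 4) := by
        have : n * s ≤ ρ / 4 := by rw [hns]; nlinarith
        calc n * s ^ 2 = (n * s) * s := by ring
          _ ≤ _ := by gcongr
      nlinarith [sq_pos_of_pos hρ]
    · ext i; simp [p]
  calc ENNReal.ofReal ((c ^ 2 * ρ / (2 * n)) ^ n) = volume (ball (p ω) s) := by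
        rw [Real.volume_pi_ball _ hs0, Fintype.card_fin, hs]
        congr 2
        field_simp
        ring
    _ ≤ μH[(n : ℝ)] (p '' (sphere 0 1 ∩ ball ω ρ)) := by rw [← hvol]; exact measure_mono hsub
    _ ≤ _ := by simpa using hp.hausdorffMeasure_image_le n.cast_nonneg (sphere 0 1 ∩ ball ω ρ)

theorem exists_card_latticePoints_ge (d M : ℕ) (hd : 2 ≤ d) (hM : 1 ≤ M) :
    ∃ N : ℕ, d * M ^ 2 ≤ N ∧ N ≤ 4 * d * M ^ 2 ∧ ∃ K : Finset (Fin d → ℕ),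
      (M : ℝ) ^ (d - 2) / (5 * d) ≤ K.card ∧
      ∀ k ∈ K, ∑ i, k i ^ 2 = N ∧ ∀ i, M ≤ k i := by
  classical
  have hmaps : ∀ k ∈ Fintype.piFinset (fun _ : Fin d => Finset.Ico M (2 * M)),
      ∑ i, k i ^ 2 ∈ Finset.Icc (d * M ^ 2) (4 * d * M ^ 2) := by
    intro k hk
    simp only [Fintype.mem_piFinset, Finset.mem_Ico] at hk
    rw [Finset.mem_Icc]
    constructor
    · refine le_trans (by simp) (Finset.card_nsmul_le_sum Finset.univ _ (M ^ 2) fun i _ => ?_)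
      exact Nat.pow_le_pow_left (hk i).1 2
    · refine (Finset.sum_le_card_nsmul Finset.univ _ ((2 * M) ^ 2) fun i _ => ?_).trans ?_
      · exact Nat.pow_le_pow_left (hk i).2.le 2
      · simp; apply le_of_eq; ring
  have hd0 : (0 : ℝ) < d := by exact_mod_cast (by omega : 0 < d)
  obtain ⟨N, hN, hb⟩ := Finset.exists_le_card_fiber_of_nsmul_le_card_of_maps_to
    (b := (M : ℝ) ^ (d - 2) / (5 * d)) hmaps ⟨d * M ^ 2, by simp; nlinarith⟩ (by
      have h1 : (Finset.Icc (d * M ^ 2) (4 * d * M ^ 2)).card ≤ 5 * d * M ^ 2 := by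
        rw [Nat.card_Icc]
        have : 1 ≤ M ^ 2 := Nat.one_le_pow _ _ hM
        have : 1 ≤ d * M ^ 2 := by nlinarith
        have : 4 * d * M ^ 2 + 1 - d * M ^ 2 ≤ 4 * d * M ^ 2 + 1 := Nat.sub_le _ _
        nlinarith
      have h2 : ((Finset.Icc (d * M ^ 2) (4 * d * M ^ 2)).card : ℝ) ≤ 5 * d * M ^ 2 := by
        exact_mod_cast h1
      have h3 : (Fintype.piFinset (fun _ : Fin d => Finset.Ico M (2 * M))).card = M ^ d := by
        simp [two_mul]
      rw [h3, nsmul_eq_mul]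
      calc _ ≤ 5 * d * (M : ℝ) ^ 2 * ((M : ℝ) ^ (d - 2) / (5 * d)) := by gcongr
        _ = (M : ℝ) ^ 2 * (M : ℝ) ^ (d - 2) := by field_simp
        _ = _ := by rw [← pow_add, Nat.add_sub_cancel' hd]; simp)
  rw [Finset.mem_Icc] at hN
  refine ⟨N, hN.1, hN.2, _, hb, fun k hk => ?_⟩
  rw [Finset.mem_filter, Fintype.mem_piFinset] at hk
  exact ⟨hk.2, fun i => (Finset.mem_Ico.1 (hk.1 i)).1⟩

/-- The union of the intervals `[m / q, m / q + δ)` for `m < L`. -/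
def comb (q δ : ℝ) (L : ℕ) : Set ℝ :=
  ⋃ m ∈ Finset.range L, Ico ((m : ℝ) / q) ((m : ℝ) / q + δ)

/-- The points of `ℝ^d` all of whose coordinates lie in `comb q δ L`. -/
def grid (d : ℕ) (q δ : ℝ) (L : ℕ) : Set (EuclideanSpace ℝ (Fin d)) :=
  WithLp.ofLp ⁻¹' univ.pi fun _ => comb q δ L

theorem measurableSet_comb (q δ : ℝ) (L : ℕ) : MeasurableSet (comb q δ L) :=
  Finset.measurableSet_biUnion _ fun _ _ => measurableSet_Ico

theorem measurableSet_grid (d : ℕ) (q δ : ℝ) (L : ℕ) : MeasurableSet (grid d q δ L) :=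
  (WithLp.measurable_ofLp 2 _) (MeasurableSet.univ_pi fun _ => measurableSet_comb q δ L)

theorem card_le_of_forall_mem_Ioo {F : Finset ℕ} {a b : ℝ} (hab : a ≤ b)
    (hF : ∀ m ∈ F, (m : ℝ) ∈ Ioo a b) : (F.card : ℝ) ≤ b - a + 1 := by
  rcases F.eq_empty_or_nonempty with rfl | hne
  · simp; linarith
  · have h1 : F ⊆ Finset.Icc (F.min' hne) (F.max' hne) := fun m hm =>
      Finset.mem_Icc.2 ⟨F.min'_le m hm, F.le_max' m hm⟩
    have h2 := Finset.card_le_card h1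
    rw [Nat.card_Icc] at h2
    have h3 : F.card + F.min' hne ≤ F.max' hne + 1 := by
      have := F.min'_le _ (F.max'_mem hne)
      omega
    have h4 : (F.card : ℝ) + (F.min' hne : ℕ) ≤ (F.max' hne : ℕ) + 1 := by exact_mod_cast h3
    have h5 := (hF _ (F.min'_mem hne)).1
    have h6 := (hF _ (F.max'_mem hne)).2
    linarith

theorem volume_comb_inter_ball_le_two_mul (q δ : ℝ) (L : ℕ) (t r : ℝ) :
    volume (comb q δ L ∩ ball t r) ≤ ENNReal.ofReal (2 * r) :=
  (measure_mono inter_subset_right).trans (Real.volume_ball t r).le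

theorem volume_biUnion_Ico_le (q δ : ℝ) (F : Finset ℕ) :
    volume (⋃ m ∈ F, Ico ((m : ℝ) / q) ((m : ℝ) / q + δ)) ≤ ENNReal.ofReal (F.card * δ) := by
  refine (measure_biUnion_finset_le _ _).trans ?_
  simp [ENNReal.ofReal_mul]

theorem volume_comb {q δ : ℝ} (hq : 0 < q) (hqδ : q * δ ≤ 1) (L : ℕ) :
    volume (comb q δ L) = ENNReal.ofReal (L * δ) := by
  have hmono : ∀ a b : ℕ, a < b → (a : ℝ) / q + δ ≤ (b : ℝ) / q := fun a b hab => by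
    have : (a : ℝ) + 1 ≤ b := by exact_mod_cast hab
    rw [le_div_iff₀ hq, add_mul, div_mul_cancel₀ _ hq.ne']
    linarith
  rw [comb, measure_biUnion_finset _ fun _ _ => measurableSet_Ico]
  · simp [ENNReal.ofReal_mul]
  · intro a _ b _ hab
    rw [Function.onFun, Set.disjoint_left]
    rintro x ⟨h1, h2⟩ ⟨h3, h4⟩
    rcases lt_or_gt_of_ne hab with h | h
    · linarith [hmono a b h]
    · linarith [hmono b a h]

theorem volume_comb_inter_ball_le {q δ : ℝ} (hq : 0 < q) (hδ : 0 ≤ δ) (hqδ : q * δ ≤ 1) (L : ℕ)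
    (t : ℝ) {r : ℝ} (hr : 0 < r) :
    volume (comb q δ L ∩ ball t r) ≤ ENNReal.ofReal ((2 * q * r + 2) * δ) := by
  classical
  set F := (Finset.range L).filter
    (fun m : ℕ => (m : ℝ) ∈ Ioo (q * (t - r - δ)) (q * (t + r))) with hF
  have hsub : comb q δ L ∩ ball t r ⊆ ⋃ m ∈ F, Ico ((m : ℝ) / q) ((m : ℝ) / q + δ) := by
    rintro x ⟨hx, hxr⟩
    simp only [comb, mem_iUnion] at hx
    obtain ⟨m, hm, hxm⟩ := hx
    refine mem_iUnion₂.2 ⟨m, Finset.mem_filter.2 ⟨hm, ?_, ?_⟩, hxm⟩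
    · rw [Real.ball_eq_Ioo] at hxr
      rw [← lt_div_iff₀' hq]
      linarith [hxr.1, hxm.2]
    · rw [Real.ball_eq_Ioo] at hxr
      rw [← div_lt_iff₀' hq]
      linarith [hxr.2, hxm.1]
  refine ((measure_mono hsub).trans (volume_biUnion_Ico_le q δ F)).trans ?_
  gcongr
  have := card_le_of_forall_mem_Ioo (F := F) (a := q * (t - r - δ)) (b := q * (t + r))
    (by gcongr; linarith) fun m hm => (Finset.mem_filter.1 hm).2
  linarith

theorem volume_grid (d : ℕ) {q δ : ℝ} (hq : 0 < q) (hδ : 0 ≤ δ) (hqδ : q * δ ≤ 1) (L : ℕ) :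
    volume (grid d q δ L) = ENNReal.ofReal ((L * δ) ^ d) := by
  rw [grid, (PiLp.volume_preserving_ofLp (Fin d)).measure_preimage
    (MeasurableSet.univ_pi fun _ => measurableSet_comb q δ L).nullMeasurableSet, volume_pi_pi]
  simp [volume_comb hq hqδ, ENNReal.ofReal_pow, hδ, mul_nonneg]

theorem volume_grid_inter_ball_le (d : ℕ) (q δ : ℝ) (L : ℕ) (x : EuclideanSpace ℝ (Fin d)) {r b : ℝ}
    (hb : 0 ≤ b) (h : ∀ t, volume (comb q δ L ∩ ball t r) ≤ ENNReal.ofReal b) :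
    volume (ball x r ∩ grid d q δ L) ≤ ENNReal.ofReal (b ^ d) := by
  have hsub : ball x r ∩ grid d q δ L ⊆
      WithLp.ofLp ⁻¹' univ.pi fun i => comb q δ L ∩ ball (x i) r := by
    rintro y ⟨hy, hyg⟩ i -
    refine ⟨hyg i trivial, ?_⟩
    rw [mem_ball, dist_eq_norm] at hy ⊢
    exact (PiLp.norm_apply_le (y - x) i).trans_lt hy
  refine (measure_mono hsub).trans ?_
  rw [(PiLp.volume_preserving_ofLp (Fin d)).measure_preimage
    (MeasurableSet.univ_pi fun i => (measurableSet_comb q δ L).inter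
      measurableSet_ball).nullMeasurableSet, volume_pi_pi]
  refine (Finset.prod_le_prod' fun i _ => h (x i)).trans ?_
  simp [ENNReal.ofReal_pow hb]

theorem cAlpha_grid_le {d : ℕ} {α q δ K : ℝ} (hα : 0 < α) (hαd : α ≤ d) {L : ℕ} (hq : 0 < q)
    (hδ : 0 < δ) (hqδ : q * δ ≤ 1) (hL : (L : ℝ) ≤ q) (hK : 1 ≤ K) (h : 1 ≤ K * q ^ d * δ ^ α) :
    cAlpha d α (volume.restrict (grid d q δ L)) ≤ ENNReal.ofReal (4 ^ d * K * (q * δ) ^ d) := by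
  refine iSup_le fun x => iSup_le fun r => iSup_le fun hr => ENNReal.div_le_of_le_mul ?_
  rw [Measure.restrict_apply measurableSet_ball, ← ENNReal.ofReal_mul (by positivity)]
  have h4 : (1 : ℝ) ≤ 4 ^ d := one_le_pow₀ (by norm_num)
  have hrd : ∀ s : ℝ, 0 < s → s ≤ 1 → s ^ d ≤ s ^ α := fun s hs hs1 => by
    rw [← Real.rpow_natCast]
    exact Real.rpow_le_rpow_of_exponent_ge hs hs1 hαd
  rcases le_total 1 r with hr1 | hr1
  · refine (volume_grid_inter_ball_le d q δ L x (b := L * δ) (by positivity) fun t =>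
      (measure_mono inter_subset_left).trans (volume_comb hq hqδ L).le).trans ?_
    gcongr
    have h1 : (1 : ℝ) ≤ r ^ α := Real.one_le_rpow hr1 hα.le
    calc (L * δ) ^ d ≤ 1 * 1 * (q * δ) ^ d * 1 := by
          rw [one_mul, one_mul, mul_one]; gcongr
      _ ≤ _ := by gcongr
  rcases le_total 1 (q * r) with hqr | hqr
  · refine (volume_grid_inter_ball_le d q δ L x (by positivity) fun t =>
      volume_comb_inter_ball_le hq hδ.le hqδ L t hr).trans ?_
    gcongr
    calc ((2 * q * r + 2) * δ) ^ d ≤ (4 * (q * r) * δ) ^ d := by gcongr; linarith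
      _ = 4 ^ d * 1 * (q * δ) ^ d * r ^ d := by rw [mul_one, ← mul_pow, ← mul_pow]; ring
      _ ≤ _ := by gcongr; exact hrd r hr hr1
  rcases le_total δ r with hδr | hδr
  · refine (volume_grid_inter_ball_le d q δ L x (by positivity) fun t =>
      volume_comb_inter_ball_le hq hδ.le hqδ L t hr).trans ?_
    gcongr
    calc ((2 * q * r + 2) * δ) ^ d ≤ (4 * δ) ^ d * 1 := by rw [mul_one]; gcongr; linarith
      _ ≤ (4 * δ) ^ d * (K * q ^ d * r ^ α) := by
          gcongr
          exact h.trans (by gcongr)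
      _ = _ := by rw [mul_pow, mul_pow]; ring
  · refine (volume_grid_inter_ball_le d q δ L x (by positivity) fun t =>
      volume_comb_inter_ball_le_two_mul q δ L t r).trans ?_
    gcongr
    have h1 : r ^ d ≤ K * q ^ d * δ ^ d * r ^ α := by
      have h2 : (r / δ) ^ d ≤ (r / δ) ^ α := hrd _ (by positivity) ((div_le_one hδ).2 hδr)
      rw [Real.div_rpow hr.le hδ.le, div_pow, div_le_div_iff₀ (by positivity) (by positivity)] at h2
      have h3 : 0 < δ ^ α := by positivity
      calc r ^ d = r ^ d * 1 := (mul_one _).symm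
        _ ≤ r ^ d * (K * q ^ d * δ ^ α) := by gcongr
        _ = K * q ^ d * (r ^ d * δ ^ α) := by ring
        _ ≤ K * q ^ d * (r ^ α * δ ^ d) := by gcongr
        _ = _ := by ring
    calc (2 * r) ^ d = 2 ^ d * r ^ d := mul_pow _ _ _
      _ ≤ 4 ^ d * (K * q ^ d * δ ^ d * r ^ α) := by gcongr; norm_num
      _ = _ := by rw [mul_pow]; ring

theorem grid_subset_closedBall {d : ℕ} {q δ : ℝ} {L : ℕ} (hq : 0 < q) (hqδ : q * δ ≤ 1)
    (hL : d * (L : ℝ) ≤ q) : grid d q δ L ⊆ closedBall 0 1 := by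
  intro x hx
  have hx' : ∀ i, d * |x i| ≤ 1 := fun i => by
    have := hx i trivial
    simp only [comb, mem_iUnion] at this
    obtain ⟨m, hm, h1, h2⟩ := this
    have hm' : (m : ℝ) + 1 ≤ L := by exact_mod_cast Finset.mem_range.1 hm
    have h0 : 0 ≤ x i := le_trans (by positivity) h1
    have h3 : q * x i ≤ L := by
      have : q * x i ≤ q * ((m : ℝ) / q + δ) := by gcongr
      rw [mul_add, mul_div_cancel₀ _ hq.ne'] at this
      linarith
    rw [abs_of_nonneg h0]
    have : q * (d * x i) ≤ q * 1 := by
      calc q * (d * x i) = d * (q * x i) := by ring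
        _ ≤ d * L := by gcongr
        _ ≤ _ := by linarith
    exact le_of_mul_le_mul_left this hq
  rw [mem_closedBall_zero_iff]
  rcases Nat.eq_zero_or_pos d with rfl | hd
  · simp [Subsingleton.elim x 0]
  have hd1 : (1 : ℝ) ≤ d := by exact_mod_cast hd
  rw [← sq_le_sq₀ (norm_nonneg _) zero_le_one, EuclideanSpace.real_norm_sq_eq]
  refine (Finset.sum_le_card_nsmul _ _ ((1 : ℝ) / d) fun i _ => ?_).trans ?_
  · rw [le_div_iff₀ (by linarith), ← sq_abs]
    have := hx' i
    nlinarith [abs_nonneg (x i)]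
  · simp; field_simp; exact le_refl _

theorem continuous_fourierMeasure {d : ℕ} (μ : Measure (EuclideanSpace ℝ (Fin d)))
    [IsFiniteMeasure μ] : Continuous (fourierMeasure μ) := by
  refine continuous_const.mul (continuous_of_dominated (bound := fun _ => 1) (fun ξ => ?_)
    (fun ξ => .of_forall fun x => ?_) (integrable_const 1) (.of_forall fun x => ?_))
  · exact Continuous.aestronglyMeasurable (by fun_prop)
  · rw [Complex.norm_exp]; simp
  · fun_prop

theorem half_le_cos_of_mem_grid {d : ℕ} {q δ : ℝ} {L : ℕ} (hq : 0 < q) (hδ : 0 < δ)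
    (hqδ : q * δ ≤ 1) (hL : d * (L : ℝ) ≤ q) {k : Fin d → ℕ} {v ξ x : EuclideanSpace ℝ (Fin d)}
    (hv : ∀ i, v i = 2 * Real.pi * q * k i) (hvδ : d * δ * ‖v‖ ≤ 1 / 2) (hξ : ‖ξ - v‖ ≤ 1 / 2)
    (hx : x ∈ grid d q δ L) : 1 / 2 ≤ Real.cos ⟪x, ξ⟫_ℝ := by
  have hx' : ∀ i, ∃ m : ℕ, (m : ℝ) / q ≤ x i ∧ x i < (m : ℝ) / q + δ := fun i => by
    have := hx i trivial
    simp only [comb, mem_iUnion] at this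
    obtain ⟨m, -, h⟩ := this
    exact ⟨m, h⟩
  choose m hm1 hm2 using hx'
  have hx1 : ‖x‖ ≤ 1 := by simpa using grid_subset_closedBall hq hqδ hL hx
  have hyv : |∑ i, (x i - m i / q) * v i| ≤ 1 / 2 := by
    refine le_trans ?_ hvδ
    refine (Finset.abs_sum_le_sum_abs _ _).trans ?_
    refine (Finset.sum_le_card_nsmul _ _ (δ * ‖v‖) fun i _ => ?_).trans (by simp [mul_assoc])
    rw [abs_mul]
    have := PiLp.norm_apply_le v i
    rw [Real.norm_eq_abs] at this
    have h2 : |x i - m i / q| ≤ δ := by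
      rw [abs_le]; constructor <;> linarith [hm1 i, hm2 i]
    gcongr
  have hxη : |⟪x, ξ - v⟫_ℝ| ≤ 1 / 2 := by
    refine (abs_real_inner_le_norm _ _).trans ?_
    nlinarith [norm_nonneg x, norm_nonneg (ξ - v)]
  have e : ⟪x, ξ⟫_ℝ = (⟪x, ξ - v⟫_ℝ + ∑ i, (x i - m i / q) * v i)
      + (∑ i, m i * k i : ℕ) * (2 * Real.pi) := by
    have h1 : ⟪x, v⟫_ℝ = ∑ i, x i * v i := by
      rw [PiLp.inner_apply]
      simp [mul_comm]
    rw [inner_sub_right, h1, Nat.cast_sum, Finset.sum_mul, add_assoc, ← Finset.sum_add_distrib,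
      sub_add_eq_add_sub, eq_sub_iff_add_eq]
    congr 1
    refine Finset.sum_congr rfl fun i _ => ?_
    rw [hv i]
    field_simp
    push_cast
    ring
  rw [e, Real.cos_add_nat_mul_two_pi]
  refine le_trans ?_ (Real.one_sub_sq_div_two_le_cos)
  have : |⟪x, ξ - v⟫_ℝ + ∑ i, (x i - m i / q) * v i| ≤ 1 :=
    (abs_add_le _ _).trans (by linarith)
  have := (sq_le_one_iff_abs_le_one _).2 this
  linarith

theorem le_norm_fourierMeasure_grid {d : ℕ} {q δ : ℝ} {L : ℕ} (hq : 0 < q) (hδ : 0 < δ)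
    (hqδ : q * δ ≤ 1) (hL : d * (L : ℝ) ≤ q) {k : Fin d → ℕ} {v ξ : EuclideanSpace ℝ (Fin d)}
    (hv : ∀ i, v i = 2 * Real.pi * q * k i) (hvδ : d * δ * ‖v‖ ≤ 1 / 2)
    (hξ : ‖ξ - v‖ ≤ 1 / 2) :
    (2 * Real.pi) ^ (-(d : ℝ) / 2) * ((L * δ) ^ d / 2) ≤
      ‖fourierMeasure (volume.restrict (grid d q δ L)) ξ‖ := by
  have hvol := volume_grid d hq hδ.le hqδ L
  have : IsFiniteMeasure (volume.restrict (grid d q δ L)) :=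
    ⟨by rw [Measure.restrict_apply_univ, hvol]; exact ENNReal.ofReal_lt_top⟩
  rw [fourierMeasure, norm_mul, Complex.norm_real, Real.norm_of_nonneg (by positivity)]
  gcongr
  have hint : Integrable (fun x => Complex.exp (-Complex.I * ((⟪x, ξ⟫_ℝ : ℝ) : ℂ)))
      (volume.restrict (grid d q δ L)) := by
    refine Integrable.of_bound (Continuous.aestronglyMeasurable (by fun_prop)) 1
      (.of_forall fun x => ?_)
    rw [Complex.norm_exp]; simp
  have hre : ∀ x, (Complex.exp (-Complex.I * ((⟪x, ξ⟫_ℝ : ℝ) : ℂ))).re = Real.cos ⟪x, ξ⟫_ℝ :=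
    fun x => by simp [Complex.exp_re]
  refine le_trans ?_ (Complex.re_le_norm _)
  have h := integral_re hint
  simp only [RCLike.re_to_complex, hre] at h
  rw [← h]
  have hcos : Integrable (fun x => Real.cos ⟪x, ξ⟫_ℝ) (volume.restrict (grid d q δ L)) := by
    simpa only [RCLike.re_to_complex, hre] using hint.re
  calc (L * δ) ^ d / 2 = ∫ x in grid d q δ L, (1 / 2 : ℝ) := by
        rw [setIntegral_const, Measure.real, hvol, ENNReal.toReal_ofReal (by positivity)]
        simp [div_eq_mul_inv]
    _ ≤ _ := setIntegral_mono_on (integrable_const _) hcos (measurableSet_grid d q δ L)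
        fun x hx => half_le_cos_of_mem_grid hq hδ hqδ hL hv hvδ hξ hx

theorem isFiniteMeasure_sphereMeasure (n : ℕ) : IsFiniteMeasure (sphereMeasure (n + 1)) := by
  refine ⟨?_⟩
  rw [sphereMeasure, Measure.restrict_apply_univ, Nat.cast_succ, add_sub_cancel_right]
  exact hausdorffMeasure_unitSphere_lt_top n

theorem le_integral_fourierMeasure_grid {n : ℕ} (hn : 1 ≤ n) {q δ R : ℝ} {L M N : ℕ} (hq : 1 ≤ q)
    (hδ : 0 < δ) (hqδ : q * δ ≤ 1) (hL : ((n + 1 : ℕ) : ℝ) * L ≤ q) (hR1 : 1 ≤ R)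
    (hR : R = 2 * Real.pi * q * √N)
    (hRδ : ((n + 1 : ℕ) : ℝ) * δ * R ≤ 1 / 2) (hM : 1 ≤ M)
    (hN : √N ≤ 2 * (n + 1 : ℕ) * M) {K : Finset (Fin (n + 1) → ℕ)}
    (hK : ∀ k ∈ K, ∑ i, k i ^ 2 = N ∧ ∀ i, M ≤ k i) :
    ((2 * Real.pi) ^ (-((n + 1 : ℕ) : ℝ) / 2) * ((L * δ) ^ (n + 1) / 2)) ^ 2 *
      (K.card * ((1 / (2 * (n + 1 : ℕ)) : ℝ) ^ 2 * (1 / (2 * R)) / (2 * n)) ^ n) ≤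
    ∫ ω, ‖fourierMeasure (volume.restrict (grid (n + 1) q δ L)) (R • ω)‖ ^ 2
      ∂(sphereMeasure (n + 1)) := by
  have hfinσ := isFiniteMeasure_sphereMeasure n
  set μ := volume.restrict (grid (n + 1) q δ L) with hμ
  have hq0 : 0 < q := by linarith
  have hR0 : 0 < R := by linarith
  have : IsFiniteMeasure μ := ⟨by
    rw [hμ, Measure.restrict_apply_univ, volume_grid _ hq0 hδ.le hqδ L]
    exact ENNReal.ofReal_lt_top⟩
  set f : EuclideanSpace ℝ (Fin (n + 1)) → ℝ := fun ω => ‖fourierMeasure μ (R • ω)‖ ^ 2 with hf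
  have hcont : Continuous f := by
    have := continuous_fourierMeasure μ
    fun_prop
  have hσsupp : ∀ᵐ ω ∂(sphereMeasure (n + 1)), ω ∈ sphere (0 : EuclideanSpace ℝ (Fin (n + 1))) 1 :=
    ae_restrict_mem isClosed_sphere.measurableSet
  have hfint : Integrable f (sphereMeasure (n + 1)) := by
    obtain ⟨B, hB⟩ := (isCompact_sphere (0 : EuclideanSpace ℝ (Fin (n + 1))) 1).exists_bound_of_continuousOn
      hcont.continuousOn
    exact Integrable.of_bound hcont.aestronglyMeasurable B (hσsupp.mono hB)
  have hsN : 0 < √(N : ℝ) := by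
    by_contra! hcon
    have : √(N : ℝ) = 0 := le_antisymm hcon (Real.sqrt_nonneg _)
    rw [hR, this] at hR0
    simp at hR0
  let w : (Fin (n + 1) → ℕ) → EuclideanSpace ℝ (Fin (n + 1)) := fun k =>
    WithLp.toLp 2 fun i => (k i : ℝ)
  let c : (Fin (n + 1) → ℕ) → EuclideanSpace ℝ (Fin (n + 1)) := fun k => (√(N : ℝ))⁻¹ • w k
  have hw : ∀ k ∈ K, ‖w k‖ = √N := fun k hk => by
    rw [EuclideanSpace.norm_eq]
    congr 1
    rw [← (hK k hk).1]
    simp [w]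
  have hc : ∀ k ∈ K, ‖c k‖ = 1 := fun k hk => by
    rw [norm_smul, hw k hk, norm_inv, Real.norm_of_nonneg hsN.le, inv_mul_cancel₀ hsN.ne']
  have hRc : ∀ k, R • c k = (2 * Real.pi * q) • w k := fun k => by
    rw [smul_smul, hR, mul_inv_cancel_right₀ hsN.ne']
  have hlow : ∀ k ∈ K, ∀ ω ∈ ball (c k) (1 / (2 * R)),
      ((2 * Real.pi) ^ (-((n + 1 : ℕ) : ℝ) / 2) * ((L * δ) ^ (n + 1) / 2)) ^ 2 ≤ f ω := by
    intro k hk ω hω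
    change _ ≤ ‖fourierMeasure μ (R • ω)‖ ^ 2
    gcongr
    refine le_norm_fourierMeasure_grid hq0 hδ hqδ hL (k := k) (v := R • c k) (fun i => ?_) ?_ ?_
    · rw [hRc]; simp [w]
    · rw [norm_smul, hc k hk, mul_one, Real.norm_of_nonneg hR0.le]; exact hRδ
    · rw [← smul_sub, norm_smul, Real.norm_of_nonneg hR0.le, ← dist_eq_norm]
      have := (mem_ball.1 hω).le
      calc R * dist ω (c k) ≤ R * (1 / (2 * R)) := by gcongr
        _ = 1 / 2 := by field_simp
  have hdisj : (K : Set (Fin (n + 1) → ℕ)).PairwiseDisjoint fun k => ball (c k) (1 / (2 * R)) := by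
    intro k _ k' _ hkk
    refine ball_disjoint_ball ?_
    obtain ⟨i, hi⟩ := Function.ne_iff.1 hkk
    have h1 : (1 : ℝ) ≤ |(k i : ℝ) - k' i| := by
      have : (1 : ℤ) ≤ |(k i : ℤ) - k' i| := Int.one_le_abs (sub_ne_zero.2 (by exact_mod_cast hi))
      exact_mod_cast this
    have h2 : 1 ≤ ‖w k - w k'‖ := h1.trans (PiLp.norm_apply_le (w k - w k') i)
    rw [dist_eq_norm, ← smul_sub, norm_smul, norm_inv, Real.norm_of_nonneg hsN.le]
    have h3 : √(N : ℝ) ≤ R := by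
      rw [hR]
      have : 1 ≤ 2 * Real.pi * q := by nlinarith [Real.pi_gt_three]
      nlinarith
    calc 1 / (2 * R) + 1 / (2 * R) = R⁻¹ * 1 := by field_simp; norm_num
      _ ≤ _ := by gcongr
  have hcap : ∀ k ∈ K, ((1 / (2 * (n + 1 : ℕ)) : ℝ) ^ 2 * (1 / (2 * R)) / (2 * n)) ^ n ≤
      (sphereMeasure (n + 1)).real (ball (c k) (1 / (2 * R))) := by
    intro k hk
    have hd0 : (1 : ℝ) ≤ (n + 1 : ℕ) := by exact_mod_cast Nat.le_add_left 1 n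
    have h := le_hausdorffMeasure_sphere_inter_ball n hn (c := 1 / (2 * (n + 1 : ℕ)))
      (by positivity) (by rw [div_le_one (by positivity)]; linarith) (hc k hk) (by
        have h1 : (M : ℝ) ≤ k (Fin.last n) := by exact_mod_cast (hK k hk).2 _
        have h0 : (0 : ℝ) < M := by exact_mod_cast hM
        simp only [c, w, PiLp.smul_apply, smul_eq_mul]
        rw [inv_mul_eq_div, div_le_div_iff₀ (by positivity) hsN]
        nlinarith) (ρ := 1 / (2 * R)) (by positivity)
        (by rw [div_le_one (by positivity)]; linarith)
    rw [Measure.real, ← ENNReal.ofReal_le_iff_le_toReal (measure_ne_top _ _)]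
    refine h.trans (le_of_eq ?_)
    rw [sphereMeasure, Measure.restrict_apply measurableSet_ball, inter_comm, Nat.cast_succ,
      add_sub_cancel_right]
  have hmeasA : MeasurableSet (⋃ k ∈ K, ball (c k) (1 / (2 * R))) :=
    Finset.measurableSet_biUnion _ fun _ _ => measurableSet_ball
  calc _ ≤ ((2 * Real.pi) ^ (-((n + 1 : ℕ) : ℝ) / 2) * ((L * δ) ^ (n + 1) / 2)) ^ 2 *
        (sphereMeasure (n + 1)).real (⋃ k ∈ K, ball (c k) (1 / (2 * R))) := by
        gcongr
        rw [measureReal_biUnion_finset hdisj fun _ _ => measurableSet_ball, ← nsmul_eq_mul]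
        exact Finset.card_nsmul_le_sum _ _ _ hcap
    _ = ∫ ω in ⋃ k ∈ K, ball (c k) (1 / (2 * R)),
        ((2 * Real.pi) ^ (-((n + 1 : ℕ) : ℝ) / 2) * ((L * δ) ^ (n + 1) / 2)) ^ 2
        ∂(sphereMeasure (n + 1)) := by
        rw [setIntegral_const, smul_eq_mul, mul_comm]
    _ ≤ ∫ ω in ⋃ k ∈ K, ball (c k) (1 / (2 * R)), f ω ∂(sphereMeasure (n + 1)) := by
        refine setIntegral_mono_on (integrable_const _) hfint.integrableOn hmeasA fun ω hω => ?_
        obtain ⟨k, hk, h⟩ := mem_iUnion₂.1 hω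
        exact hlow k hk ω h
    _ ≤ _ := setIntegral_le_integral hfint (.of_forall fun ω => by positivity)

theorem rpow_neg_le_pow_div_pow {D α q R M : ℝ} {m : ℕ} (hm : (m : ℝ) = D - 2) (hD : 0 < D)
    (hq : 0 < q) (hR : 1 ≤ R) (hqR : q ≤ R ^ (α / D))
    (hM : R ≤ 4 * Real.pi * D * q * M) :
    (4 * Real.pi * D) ^ (-(m : ℝ)) * R ^ (-(α - 1 + 2 * (D - α) / D)) ≤ M ^ m / R ^ (m + 1) := by
  have hR0 : 0 < R := by linarith
  have hA : 0 < 4 * Real.pi * D := by positivity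
  have h1 : q ^ m ≤ R ^ (α / D * m) := by
    rw [Real.rpow_mul hR0.le, Real.rpow_natCast]
    gcongr
  have h2 : R ^ m ≤ (4 * Real.pi * D) ^ m * R ^ (α / D * m) * M ^ m := by
    have hM0 : 0 < M := by
      by_contra! hcon
      have : 4 * Real.pi * D * q * M ≤ 0 := mul_nonpos_of_nonneg_of_nonpos (by positivity) hcon
      linarith
    calc R ^ m ≤ (4 * Real.pi * D * q * M) ^ m := by gcongr
      _ = (4 * Real.pi * D) ^ m * q ^ m * M ^ m := by rw [mul_pow, mul_pow]
      _ ≤ _ := by gcongr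
  have e : -(α - 1 + 2 * (D - α) / D) = -(α / D * m) - 1 := by
    rw [hm]; field_simp; ring
  rw [e, Real.rpow_sub hR0, Real.rpow_one, Real.rpow_neg hR0.le, Real.rpow_neg hA.le,
    Real.rpow_natCast, le_div_iff₀ (by positivity), pow_succ]
  have hX : 0 < R ^ (α / D * m) := by positivity
  calc _ = R ^ m / ((4 * Real.pi * D) ^ m * R ^ (α / D * m)) := by field_simp
    _ ≤ _ := by rw [div_le_iff₀ (by positivity)]; linarith

theorem exists_nat_half_le_le {x : ℝ} (hx : 1 ≤ x) : ∃ M : ℕ, 1 ≤ M ∧ x / 2 ≤ M ∧ (M : ℝ) ≤ x := by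
  have h1 : 1 ≤ ⌊x⌋₊ := Nat.le_floor (by simpa using hx)
  refine ⟨⌊x⌋₊, h1, ?_, Nat.floor_le (by linarith)⟩
  have h2 : (1 : ℝ) ≤ ⌊x⌋₊ := by exact_mod_cast h1
  linarith [Nat.lt_floor_add_one x]

theorem exists_forall_lt_mul_rpow {a b β β' : ℝ} (hb : 0 < b) (hβ : β' < β) :
    ∃ T : ℝ, ∀ R, T ≤ R → 1 ≤ R → a * R ^ (-β) < b * R ^ (-β') := by
  obtain ⟨T, hT⟩ := Filter.eventually_atTop.1
    ((tendsto_rpow_atTop (sub_pos.2 hβ)).eventually_gt_atTop (a / b))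
  refine ⟨T, fun R hR hR1 => ?_⟩
  have h := hT R hR
  have hR0 : 0 < R := by linarith
  rw [div_lt_iff₀ hb] at h
  have e : R ^ (-β') = R ^ (β - β') * R ^ (-β) := by
    rw [← Real.rpow_add hR0]; congr 1; ring
  rw [e, ← mul_assoc, mul_comm b]
  gcongr

theorem exists_radius_and_latticePoints {d : ℕ} (hd : 2 ≤ d) {α q : ℝ} (hα : 0 < α) (hαd : α < d)
    (hq : 1 ≤ q) : ∃ (R : ℝ) (M N : ℕ) (K : Finset (Fin d → ℕ)), q ≤ R ∧
      R = 2 * Real.pi * q * √N ∧ 1 ≤ M ∧ √N ≤ 2 * d * M ∧ q ≤ R ^ (α / d) ∧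
      R ^ α ≤ (4 * Real.pi * d) ^ α * q ^ d ∧ R ≤ 4 * Real.pi * d * q * M ∧
      (M : ℝ) ^ (d - 2) / (5 * d) ≤ K.card ∧ ∀ k ∈ K, ∑ i, k i ^ 2 = N ∧ ∀ i, M ≤ k i := by
  have hq0 : 0 < q := by linarith
  have hD2 : (2 : ℝ) ≤ d := by exact_mod_cast hd
  have hγ : 0 < d / α - 1 := by rw [sub_pos, one_lt_div hα]; exact hαd
  obtain ⟨M, hM1, hM2, hM3⟩ := exists_nat_half_le_le (Real.one_le_rpow hq hγ.le)
  obtain ⟨N, hN1, hN2, K, hKc, hK⟩ := exists_card_latticePoints_ge d M hd hM1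
  have hMpos : (1 : ℝ) ≤ M := by exact_mod_cast hM1
  have hN1' : (d : ℝ) * M ^ 2 ≤ N := by exact_mod_cast hN1
  have hN2' : (N : ℝ) ≤ 4 * d * M ^ 2 := by exact_mod_cast hN2
  have hlow : (M : ℝ) ≤ √N := Real.le_sqrt_of_sq_le (by nlinarith)
  have hupp : √(N : ℝ) ≤ 2 * d * M := by
    rw [Real.sqrt_le_left (by positivity)]
    have : (d : ℝ) ≤ d ^ 2 := by nlinarith
    calc (N : ℝ) ≤ 4 * d * M ^ 2 := hN2'
      _ ≤ 4 * d ^ 2 * M ^ 2 := by gcongr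
      _ = _ := by ring
  have hpi := Real.pi_gt_three
  have hqq : q * q ^ ((d : ℝ) / α - 1) = q ^ ((d : ℝ) / α) := by
    rw [Real.rpow_sub_one hq0.ne']; field_simp
  have hRlow : q ^ ((d : ℝ) / α) ≤ 2 * Real.pi * q * √N := by
    calc q ^ ((d : ℝ) / α) = 1 * q * q ^ ((d : ℝ) / α - 1) := by rw [one_mul, hqq]
      _ ≤ Real.pi * q * q ^ ((d : ℝ) / α - 1) := by gcongr; linarith
      _ = 2 * Real.pi * q * (q ^ ((d : ℝ) / α - 1) / 2) := by ring
      _ ≤ _ := by gcongr; exact hM2.trans hlow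
  have hRupp : 2 * Real.pi * q * √N ≤ 4 * Real.pi * d * q * M := by
    calc 2 * Real.pi * q * √N ≤ 2 * Real.pi * q * (2 * d * M) := by gcongr
      _ = _ := by ring
  refine ⟨_, M, N, K, ?_, rfl, hM1, hupp, ?_, ?_, hRupp, hKc, hK⟩
  · refine le_trans ?_ hRlow
    have : (1 : ℝ) ≤ d / α := by linarith
    simpa using Real.rpow_le_rpow_of_exponent_le hq this
  · calc q = (q ^ ((d : ℝ) / α)) ^ (α / d) := by
          rw [← Real.rpow_mul hq0.le]
          have : (d : ℝ) / α * (α / d) = 1 := by field_simp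
          rw [this, Real.rpow_one]
      _ ≤ _ := by gcongr
  · calc (2 * Real.pi * q * √N) ^ α ≤ (4 * Real.pi * d * q ^ ((d : ℝ) / α)) ^ α := by
          refine Real.rpow_le_rpow (by positivity) ?_ hα.le
          calc _ ≤ 4 * Real.pi * d * q * M := hRupp
            _ ≤ 4 * Real.pi * d * q * q ^ ((d : ℝ) / α - 1) := by gcongr
            _ = _ := by rw [mul_assoc _ q, hqq]
      _ = _ := by
          rw [Real.mul_rpow (by positivity) (by positivity), ← Real.rpow_mul hq0.le,
            div_mul_cancel₀ _ hα.ne', Real.rpow_natCast]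

theorem stmt1 (d : ℕ) (hd : 4 ≤ d) (α : ℝ) (hα0 : 0 < α) (hαd : α < d)
    (β : ℝ) (hβ : α - 1 + 2 * ((d : ℝ) - α) / d < β) (C : ℝ) (hC : 0 < C) :
    ∃ μ : Measure (EuclideanSpace ℝ (Fin d)), IsAlphaDimensional d α μ ∧
      ∃ R : ℝ, 1 < R ∧
        C * (cAlpha d α μ).toReal * (μ univ).toReal * R ^ (-β)
          < ∫ ω, ‖fourierMeasure μ (R • ω)‖ ^ 2 ∂(sphereMeasure d) := by
  obtain ⟨m, rfl⟩ : ∃ m, d = m + 1 + 1 := ⟨d - 2, by omega⟩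
  set D : ℝ := ((m + 1 + 1 : ℕ) : ℝ) with hDdef
  have hD4 : 4 ≤ D := by rw [hDdef]; exact_mod_cast hd
  have hD0 : 0 < D := by linarith
  have hmD : (m : ℝ) = D - 2 := by rw [hDdef]; push_cast; ring
  have hpi := Real.pi_gt_three
  set A : ℝ := (8 * Real.pi * D ^ 2) ^ α with hA
  have hA1 : 1 ≤ A := Real.one_le_rpow (by nlinarith) hα0.le
  set κ : ℝ := (1 / (2 * D)) ^ 2 / (4 * (m + 1 : ℕ)) with hκ
  have hκ0 : 0 < κ := by positivity
  set G : ℝ := (2 * Real.pi) ^ (-D / 2) with hG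
  have hG0 : 0 < G := by positivity
  set b : ℝ := (G / 2) ^ 2 * κ ^ (m + 1) * (4 * Real.pi * D) ^ (-(m : ℝ)) / (5 * D) with hb
  have hb0 : 0 < b := by positivity
  obtain ⟨T, hT⟩ := exists_forall_lt_mul_rpow
    (a := C * (4 ^ (m + 1 + 1) * A * D ^ (m + 1 + 1))) hb0 hβ
  obtain ⟨L, hLT⟩ := exists_nat_ge (max T 1)
  have hL1 : (1 : ℝ) ≤ L := (le_max_right _ _).trans hLT
  obtain ⟨R, M, N, K, hqR, hR, hM, hN, hqRα, hRα, hRM, hKc, hK⟩ :=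
    exists_radius_and_latticePoints (d := m + 1 + 1) (by omega) (q := D * L) hα0 hαd (by nlinarith)
  rw [← hDdef] at hN hqRα hRα hRM hKc
  have hLq : (L : ℝ) ≤ D * L := by nlinarith
  have hq1 : 1 ≤ D * L := by linarith
  have hq0 : 0 < D * L := by linarith
  have hR1 : 1 < R := by nlinarith
  have hR0 : 0 < R := by linarith
  have hTR : T ≤ R := ((le_max_left _ _).trans hLT).trans (hLq.trans hqR)
  set δ : ℝ := 1 / (2 * D * R) with hδ
  have hδ0 : 0 < δ := by positivity
  have hDδ : D * δ * R = 1 / 2 := by rw [hδ]; field_simp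
  have hqδ : D * L * δ ≤ 1 := by
    calc D * L * δ ≤ R * δ := by gcongr
      _ ≤ D * (R * δ) := le_mul_of_one_le_left (by positivity) (by linarith)
      _ = D * δ * R := by ring
      _ ≤ 1 := by rw [hDδ]; norm_num
  have hKA : 1 ≤ A * (D * L) ^ (m + 1 + 1) * δ ^ α := by
    have h1 : δ ^ α = ((2 * D) ^ α)⁻¹ * (R ^ α)⁻¹ := by
      rw [hδ, one_div, Real.inv_rpow (by positivity), Real.mul_rpow (by positivity) hR0.le, mul_inv]
    have h2 : A = (2 * D) ^ α * (4 * Real.pi * D) ^ α := by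
      rw [← Real.mul_rpow (by positivity) (by positivity), hA]; congr 1; ring
    have h3 : 0 < (2 * D) ^ α := by positivity
    have h4 : 0 < R ^ α := by positivity
    rw [h1, h2]
    calc (1 : ℝ) ≤ (4 * Real.pi * D) ^ α * (D * L) ^ (m + 1 + 1) / R ^ α := by
          rw [le_div_iff₀ h4, one_mul]; exact hRα
      _ = _ := by field_simp
  have hcα := cAlpha_grid_le (d := m + 1 + 1) hα0 hαd.le hq0 hδ0 hqδ hLq hA1 hKA
  refine ⟨volume.restrict (grid (m + 1 + 1) (D * L) δ L), ⟨?_, ?_⟩, R, hR1, ?_⟩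
  · rw [Measure.restrict_apply isClosed_closedBall.measurableSet.compl,
      ← Set.sdiff_eq_compl_inter, Set.sdiff_eq_empty.2 (grid_subset_closedBall hq0 hqδ le_rfl),
      measure_empty]
  · exact ne_top_of_le_ne_top ENNReal.ofReal_ne_top hcα
  refine lt_of_lt_of_le ?_ (le_integral_fourierMeasure_grid (n := m + 1) (by omega) hq1 hδ0 hqδ le_rfl
    hR1.le hR hDδ.le hM hN hK)
  rw [← hDdef, ← hG, Measure.restrict_apply_univ, volume_grid _ hq0 hδ0.le hqδ,
    ENNReal.toReal_ofReal (by positivity)]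
  have hcα' := ENNReal.toReal_le_of_le_ofReal (by positivity) hcα
  set V : ℝ := (L * δ) ^ (m + 1 + 1) with hV
  have hV0 : 0 < V := by positivity
  have hqV : (D * L * δ) ^ (m + 1 + 1) = D ^ (m + 1 + 1) * V := by
    rw [mul_assoc, mul_pow]
  rw [hqV] at hcα'
  have hκR : ((1 / (2 * D)) ^ 2 * (1 / (2 * R)) / (2 * (m + 1 : ℕ))) ^ (m + 1) =
      κ ^ (m + 1) / R ^ (m + 1) := by
    rw [← div_pow, hκ]; congr 1; field_simp; norm_num
  rw [hκR]
  have hfinal := rpow_neg_le_pow_div_pow hmD hD0 hq0 hR1.le hqRα hRM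
  calc _ ≤ C * (4 ^ (m + 1 + 1) * A * (D ^ (m + 1 + 1) * V)) * V * R ^ (-β) := by gcongr
    _ = V ^ 2 * (C * (4 ^ (m + 1 + 1) * A * D ^ (m + 1 + 1)) * R ^ (-β)) := by ring
    _ < V ^ 2 * (b * R ^ (-(α - 1 + 2 * (D - α) / D))) := by
        exact mul_lt_mul_of_pos_left (hT R hTR hR1.le) (by positivity)
    _ = V ^ 2 * ((G / 2) ^ 2 * κ ^ (m + 1) / (5 * D)) *
        ((4 * Real.pi * D) ^ (-(m : ℝ)) * R ^ (-(α - 1 + 2 * (D - α) / D))) := by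
        rw [hb]; ring
    _ ≤ V ^ 2 * ((G / 2) ^ 2 * κ ^ (m + 1) / (5 * D)) * ((M : ℝ) ^ m / R ^ (m + 1)) := by gcongr
    _ = (G * (V / 2)) ^ 2 * ((M : ℝ) ^ m / (5 * D) * (κ ^ (m + 1) / R ^ (m + 1))) := by ring
    _ ≤ _ := by gcongr; exact hKc
end

section
/- Let d ≥ 2, 0 < s < d/2 and 0 < α ≤ d. Suppose there exist β > d − 2s and a constant C₀ such that for every α-dimensional measure ν on ℝ^d and every R > 1 one has ∫_{S^{d−1}} |ν̂(Rω)|² dσ(ω) ≤ C₀ · c_α(ν) · ν(ℝ^d) · R^{−β}. Then for every pair (v₀, v₁) ∈ Ḣ^s(ℝ^d) × Ḣ^{s−1}(ℝ^d), the divergence set of the wave solution satisfies dim_H D(v₀, v₁) ≤ α. -/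
open MeasureTheory Metric Filter Set
open scoped ENNReal InnerProductSpace Topology

/-- The frequency-truncated wave evolution with data given on the Fourier side by
`F₀ = v̂₀` and `F₁ = v̂₁`:
`∫ ψ(|ξ|/N) (f̂₊(ξ) e^{i(x·ξ + t|ξ|)} + f̂₋(ξ) e^{i(x·ξ - t|ξ|)}) dξ`,
where `f̂_± = (1/2)(F₀ ∓ i|ξ|⁻¹ F₁)`. -/
noncomputable def wavePartial (d : ℕ) (ψ : SchwartzMap ℝ ℝ)
    (F₀ F₁ : EuclideanSpace ℝ (Fin d) → ℂ) (x : EuclideanSpace ℝ (Fin d)) (t N : ℝ) : ℂ :=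
  ∫ ξ, ((ψ (‖ξ‖ / N) : ℝ) : ℂ) *
    ((1 / 2 : ℂ) * (F₀ ξ - Complex.I * ((‖ξ‖⁻¹ : ℝ) : ℂ) * F₁ ξ) *
        Complex.exp (Complex.I * (((⟪x, ξ⟫_ℝ : ℝ) : ℂ) + (t : ℂ) * ((‖ξ‖ : ℝ) : ℂ))) +
      (1 / 2 : ℂ) * (F₀ ξ + Complex.I * ((‖ξ‖⁻¹ : ℝ) : ℂ) * F₁ ξ) *
        Complex.exp (Complex.I * (((⟪x, ξ⟫_ℝ : ℝ) : ℂ) - (t : ℂ) * ((‖ξ‖ : ℝ) : ℂ))))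

/-- The pointwise wave solution (junk value if the limit does not exist).  At `t = 0` this
is the canonical pointwise representative of the datum `v₀`. -/
noncomputable def waveSol (d : ℕ) (ψ : SchwartzMap ℝ ℝ)
    (F₀ F₁ : EuclideanSpace ℝ (Fin d) → ℂ) (x : EuclideanSpace ℝ (Fin d)) (t : ℝ) : ℂ :=
  limUnder atTop (fun N : ℝ => wavePartial d ψ F₀ F₁ x t N)

/-- The divergence set `D(v₀, v₁)`: the points `x` for which it fails that `v(x,t)` is
defined for all small `t` and `v(x,t) → v₀(x)` as `t → 0`. -/
def waveDivergenceSet (d : ℕ) (ψ : SchwartzMap ℝ ℝ)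
    (F₀ F₁ : EuclideanSpace ℝ (Fin d) → ℂ) : Set (EuclideanSpace ℝ (Fin d)) :=
  {x | ¬ ((∃ L : ℂ, Tendsto (fun N : ℝ => wavePartial d ψ F₀ F₁ x 0 N) atTop (𝓝 L)) ∧
      ∃ t₀ : ℝ, 0 < t₀ ∧
        (∀ t : ℝ, t ≠ 0 → |t| < t₀ →
          ∃ L : ℂ, Tendsto (fun N : ℝ => wavePartial d ψ F₀ F₁ x t N) atTop (𝓝 L)) ∧
        Tendsto (fun t => waveSol d ψ F₀ F₁ x t) (𝓝[≠] (0 : ℝ))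
          (𝓝 (waveSol d ψ F₀ F₁ x 0)))}

section

open scoped NNReal Pointwise

/-- Euclidean space of dimension `d`. -/
abbrev Euc (d : ℕ) := EuclideanSpace ℝ (Fin d)

theorem toSphere_le_diam_pow (n : ℕ) : ∃ C : ℝ≥0, C ≠ 0 ∧
    ∀ (s : Set (sphere (0 : Euc (n + 1)) 1)) (δ : ℝ), 0 < δ → δ ≤ 1 →
      MeasurableSet s → (∀ x ∈ s, ∀ y ∈ s, dist x y ≤ δ) →
      (volume : Measure (Euc (n + 1))).toSphere s
        ≤ C * ENNReal.ofReal (δ ^ n) := by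
  set V : ℝ≥0 := (volume (ball (0 : Euc (n + 1)) 1)).toNNReal
  have hV : (V : ℝ≥0∞) = volume (ball (0 : Euc (n + 1)) 1) :=
    ENNReal.coe_toNNReal measure_ball_lt_top.ne
  have hV0 : V ≠ 0 := by
    intro h
    have h2 : volume (ball (0 : Euc (n + 1)) 1) ≠ 0 := (measure_ball_pos _ _ one_pos).ne'
    rw [← hV, h] at h2; simp at h2
  refine ⟨(n + 1 : ℕ) * (2 * 3 ^ (n + 1) * V), by positivity, ?_⟩
  intro s δ hδ hδ1 hs hdiam
  rw [Measure.toSphere_apply' _ hs]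
  have hfin : Module.finrank ℝ (Euc (n + 1)) = n + 1 := by simp
  rw [hfin, Nat.cast_add, Nat.cast_one]
  rcases s.eq_empty_or_nonempty with rfl | ⟨θ, hθ⟩
  · simp
  set N : ℕ := ⌈δ⁻¹⌉₊ with hN
  have hcov : Ioo (0 : ℝ) 1 • ((↑) '' s : Set (Euc (n + 1))) ⊆
      ⋃ j ∈ Finset.range N, ball ((j * δ) • (θ : Euc (n + 1))) (3 * δ) := by
    rintro _ ⟨t, ht, _, ⟨ω, hω, rfl⟩, rfl⟩
    have h0 : 0 ≤ t / δ := div_nonneg ht.1.le hδ.le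
    simp only [mem_iUnion, Finset.mem_range]
    refine ⟨⌊t / δ⌋₊, ?_, ?_⟩
    · rw [Nat.floor_lt h0]
      calc t / δ < 1 / δ := by gcongr; exact ht.2
        _ ≤ N := by rw [one_div]; exact Nat.le_ceil _
    · have h1 := Nat.floor_le h0
      have h2 := Nat.lt_floor_add_one (t / δ)
      rw [le_div_iff₀ hδ] at h1
      rw [div_lt_iff₀ hδ] at h2
      have hθ1 : ‖(θ : Euc (n + 1))‖ = 1 := by simp
      have hd : ‖(ω : Euc (n + 1)) - θ‖ ≤ δ := by
        rw [← dist_eq_norm]; exact hdiam ω hω θ hθ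
      simp only [mem_ball, dist_eq_norm]
      calc ‖t • (ω : Euc (n + 1)) - ((⌊t / δ⌋₊ : ℝ) * δ) • (θ : Euc (n + 1))‖
          = ‖t • ((ω : Euc (n + 1)) - θ) + (t - ⌊t / δ⌋₊ * δ) • (θ : Euc (n + 1))‖ := by
            congr 1; rw [smul_sub, sub_smul]; abel
        _ ≤ t * ‖(ω : Euc (n + 1)) - θ‖ + |t - ⌊t / δ⌋₊ * δ| * 1 := by
            refine (norm_add_le _ _).trans ?_
            rw [norm_smul, norm_smul, hθ1, Real.norm_eq_abs, Real.norm_eq_abs, abs_of_pos ht.1]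
        _ < 3 * δ := by
            rw [abs_of_nonneg (by linarith)]
            nlinarith [ht.1, ht.2, norm_nonneg ((ω : Euc (n + 1)) - θ)]
  calc ((n : ℝ≥0∞) + 1) * volume (Ioo (0 : ℝ) 1 • ((↑) '' s : Set (Euc (n + 1))))
      ≤ ((n : ℝ≥0∞) + 1) * ∑ j ∈ Finset.range N,
          volume (ball (((j : ℝ) * δ) • (θ : Euc (n + 1))) (3 * δ)) := by
        gcongr
        exact (measure_mono hcov).trans (measure_biUnion_finset_le _ _)
    _ = ((n : ℝ≥0∞) + 1) * (N * (ENNReal.ofReal ((3 * δ) ^ (n + 1)) * V)) := by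
        congr 1
        rw [Finset.sum_congr rfl (fun j _ => Measure.addHaar_ball volume _ (by positivity)), hfin,
          Finset.sum_const, Finset.card_range, nsmul_eq_mul, hV]
    _ ≤ ((n : ℝ≥0∞) + 1) * (ENNReal.ofReal (2 * δ⁻¹) *
        (ENNReal.ofReal ((3 * δ) ^ (n + 1)) * V)) := by
        gcongr
        rw [← ENNReal.ofReal_natCast]
        apply ENNReal.ofReal_le_ofReal
        have := Nat.ceil_lt_add_one (inv_nonneg.2 hδ.le)
        have h1 : 1 ≤ δ⁻¹ := (one_le_inv₀ hδ).2 hδ1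
        rw [hN]; linarith
    _ = _ := by
        have : ENNReal.ofReal (2 * δ⁻¹) * ENNReal.ofReal ((3 * δ) ^ (n + 1)) =
            2 * 3 ^ (n + 1) * ENNReal.ofReal (δ ^ n) := by
          rw [← ENNReal.ofReal_mul (by positivity)]
          have h3 : (2 : ℝ≥0∞) * 3 ^ (n + 1) = ENNReal.ofReal (2 * 3 ^ (n + 1)) := by
            rw [ENNReal.ofReal_mul (by norm_num), ENNReal.ofReal_pow (by norm_num)]; simp
          rw [h3, ← ENNReal.ofReal_mul (by positivity)]
          congr 1
          field_simp
          ring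
        push_cast
        rw [← mul_assoc (ENNReal.ofReal (2 * δ⁻¹)), this]
        ring

theorem ediam_le_bound {X : Type*} [PseudoMetricSpace X] {s : Set X} {ε : ℝ}
    (h : ediam s ≤ ENNReal.ofReal ε) (hε : 0 ≤ ε) : ∀ x ∈ s, ∀ y ∈ s, dist x y ≤ ε := by
  intro x hx y hy
  have := (edist_le_ediam_of_mem hx hy).trans h
  rwa [edist_dist, ENNReal.ofReal_le_ofReal_iff hε] at this

theorem exists_map_toSphere_le_hausdorff (n : ℕ) (hn : 0 < n) : ∃ C : ℝ≥0,
    Measure.map Subtype.val (volume : Measure (Euc (n + 1))).toSphere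
      ≤ (C : ℝ≥0∞) • sphereMeasure (n + 1) := by
  obtain ⟨C, hC0, hC⟩ := toSphere_le_diam_pow n
  set τ : Measure (Euc (n + 1)) :=
    Measure.map Subtype.val (volume : Measure (Euc (n + 1))).toSphere with hτ
  have hC0' : (C : ℝ≥0∞) ≠ 0 := by simpa using hC0
  have hle : (C : ℝ≥0∞)⁻¹ • τ ≤ μH[(n : ℝ)] := by
    refine Measure.le_hausdorffMeasure _ _ 1 one_pos ?_
    intro s hs
    have hs' : (C : ℝ≥0∞)⁻¹ * τ (closure s) ≤ ediam s ^ (n : ℝ) := by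
      rw [ENNReal.rpow_natCast]
      have hfin : ediam s ≠ ⊤ := (hs.trans_lt ENNReal.one_lt_top).ne
      have key : ∀ δ : ℝ, 0 < δ → δ ≤ 1 → ediam s ≤ ENNReal.ofReal δ →
          (C : ℝ≥0∞)⁻¹ * τ (closure s) ≤ ENNReal.ofReal δ ^ n := by
        intro δ hδ hδ1 hd
        rw [← ENNReal.ofReal_pow hδ.le, ENNReal.inv_mul_le_iff hC0' ENNReal.coe_ne_top, hτ,
          Measure.map_apply measurable_subtype_coe isClosed_closure.measurableSet]
        apply hC _ _ hδ hδ1 (measurable_subtype_coe isClosed_closure.measurableSet)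
        intro x hx y hy
        rw [← ediam_closure] at hd
        exact ediam_le_bound hd hδ.le x hx y hy
      rcases eq_or_ne (ediam s) 0 with h0 | h0
      · rw [h0, zero_pow hn.ne']
        have ht : Tendsto (fun δ : ℝ => ENNReal.ofReal δ ^ n) (𝓝[>] 0) (𝓝 (0 ^ n)) := by
          have : Continuous (fun δ : ℝ => ENNReal.ofReal δ ^ n) :=
            (ENNReal.continuous_pow n).comp ENNReal.continuous_ofReal
          have h2 := this.tendsto 0
          simp only [ENNReal.ofReal_zero] at h2
          exact h2.mono_left nhdsWithin_le_nhds
        rw [zero_pow hn.ne'] at ht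
        refine ge_of_tendsto ht ?_
        filter_upwards [Ioc_mem_nhdsGT one_pos] with δ hδ
        exact key δ hδ.1 hδ.2 (by simp [h0])
      · have := key (ediam s).toReal (ENNReal.toReal_pos h0 hfin)
          (ENNReal.toReal_le_of_le_ofReal zero_le_one (by simpa using hs))
          (by rw [ENNReal.ofReal_toReal hfin])
        rwa [ENNReal.ofReal_toReal hfin] at this
    refine le_trans ?_ hs'
    rw [Measure.smul_apply, smul_eq_mul]
    gcongr
    exact subset_closure
  refine ⟨C, ?_⟩
  refine Measure.le_iff.2 fun A hA => ?_
  have h1 : τ A = τ (A ∩ sphere 0 1) := by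
    rw [hτ, Measure.map_apply measurable_subtype_coe hA,
      Measure.map_apply measurable_subtype_coe (hA.inter isClosed_sphere.measurableSet)]
    congr 1
    ext x; simp
  have h2 := Measure.le_iff'.1 hle (A ∩ sphere 0 1)
  rw [Measure.smul_apply, smul_eq_mul, ENNReal.inv_mul_le_iff hC0' ENNReal.coe_ne_top] at h2
  rw [h1, Measure.smul_apply, smul_eq_mul, sphereMeasure, Measure.restrict_apply hA]
  simpa using h2

theorem norm_inv_smul_sub_le {E : Type*} [NormedAddCommGroup E] [NormedSpace ℝ E] {x y : E}
    (hx : 1 ≤ ‖x‖) (hy : 1 ≤ ‖y‖) :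
    ‖‖x‖⁻¹ • x - ‖y‖⁻¹ • y‖ ≤ 2 * ‖x - y‖ := by
  have hx0 : 0 < ‖x‖ := by linarith
  have hy0 : 0 < ‖y‖ := by linarith
  have h1 : ‖x‖⁻¹ • x - ‖y‖⁻¹ • y = ‖x‖⁻¹ • (x - y) + (‖x‖⁻¹ - ‖y‖⁻¹) • y := by
    rw [smul_sub, sub_smul]; abel
  have h2 : ‖(‖x‖⁻¹ - ‖y‖⁻¹) • y‖ = ‖x‖⁻¹ * |‖y‖ - ‖x‖| := by
    rw [norm_smul, Real.norm_eq_abs, inv_sub_inv hx0.ne' hy0.ne', abs_div, abs_mul,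
      abs_of_pos hx0, abs_of_pos hy0]
    field_simp
  have h3 : ‖x‖⁻¹ ≤ 1 := inv_le_one_of_one_le₀ hx
  have h4 : |‖y‖ - ‖x‖| ≤ ‖x - y‖ := by rw [norm_sub_rev]; exact abs_norm_sub_norm_le _ _
  calc _ ≤ ‖x‖⁻¹ * ‖x - y‖ + ‖x‖⁻¹ * |‖y‖ - ‖x‖| := by
        rw [h1]; refine (norm_add_le _ _).trans ?_
        rw [h2, norm_smul, norm_inv, norm_norm]
    _ ≤ 1 * ‖x - y‖ + 1 * ‖x - y‖ := by gcongr
    _ = _ := by ring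

theorem hausdorff_sphere_lt_top (n : ℕ) :
    μH[(n : ℝ)] (sphere (0 : Euc (n + 1)) 1) < ⊤ := by
  let g : Fin (n + 1) → ℝ → (Fin n → ℝ) → Euc (n + 1) :=
    fun i c y => WithLp.toLp 2 (i.insertNth c y)
  let P : Euc (n + 1) → Euc (n + 1) := fun x => ‖x‖⁻¹ • x
  have hgn : ∀ i c y, |c| ≤ ‖g i c y‖ := by
    intro i c y
    have := PiLp.norm_apply_le (g i c y) i
    simpa [g] using this
  have hlip : ∀ i c, ∃ K : ℝ≥0, LipschitzWith K (g i c) := by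
    intro i c
    refine ⟨_, (PiLp.lipschitzWith_toLp 2 (fun _ : Fin (n + 1) => ℝ)).comp (Kg := 1) ?_⟩
    refine LipschitzWith.of_dist_le_mul fun y z => ?_
    rw [NNReal.coe_one, one_mul, dist_pi_le_iff dist_nonneg]
    intro j
    refine Fin.succAboveCases i ?_ (fun k => ?_) j
    · simp
    · simpa using dist_le_pi_dist y z k
  have hsub : sphere (0 : Euc (n + 1)) 1 ⊆ ⋃ i : Fin (n + 1), ⋃ b : Bool,
      (P ∘ g i (if b then 1 else -1)) '' closedBall 0 1 := by
    intro x hx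
    have hx1 : ‖x‖ = 1 := by simpa using hx
    obtain ⟨i, hi⟩ := Finite.exists_max (fun i => |x i|)
    have hi0 : x i ≠ 0 := by
      intro h0
      have : x = 0 := by
        ext j
        have := hi j
        rw [h0, abs_zero] at this
        simpa using abs_nonpos_iff.1 this
      rw [this] at hx1; simp at hx1
    simp only [mem_iUnion]
    have hpos : 0 < |x i| := abs_pos.2 hi0
    refine ⟨i, decide (0 < x i), fun k => |x i|⁻¹ * x (i.succAbove k), ?_, ?_⟩
    · rw [mem_closedBall, dist_zero_right, pi_norm_le_iff_of_nonneg zero_le_one]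
      intro k
      rw [Real.norm_eq_abs, abs_mul, abs_inv, abs_abs, inv_mul_le_iff₀ hpos, mul_one]
      exact hi _
    · have : g i (if decide (0 < x i) = true then 1 else -1)
          (fun k => |x i|⁻¹ * x (i.succAbove k)) = |x i|⁻¹ • x := by
        ext j
        refine Fin.succAboveCases i ?_ (fun k => ?_) j
        · rw [PiLp.smul_apply, smul_eq_mul]
          simp only [g, Fin.insertNth_apply_same]
          rcases lt_or_gt_of_ne hi0 with h | h
          · rw [abs_of_neg h]; simp [h.not_gt]; grind
          · rw [abs_of_pos h]; simp [h]; grind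
        · rw [PiLp.smul_apply, smul_eq_mul]; simp [g]
      simp only [Function.comp, P]
      rw [this, norm_smul, hx1, norm_inv, Real.norm_eq_abs, abs_abs, mul_one, inv_inv, smul_smul,
        mul_inv_cancel₀ hpos.ne', one_smul]
  refine (measure_mono hsub).trans_lt ?_
  refine (measure_iUnion_fintype_le _ _).trans_lt (ENNReal.sum_lt_top.2 fun i _ => ?_)
  refine (measure_iUnion_fintype_le _ _).trans_lt (ENNReal.sum_lt_top.2 fun b _ => ?_)
  set c : ℝ := if b then 1 else -1 with hc
  have hc1 : |c| = 1 := by rw [hc]; split_ifs <;> simp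
  obtain ⟨K, hK⟩ := hlip i c
  have hL : LipschitzWith (2 * K) (P ∘ g i c) := by
    refine LipschitzWith.of_dist_le_mul fun y z => ?_
    rw [dist_eq_norm]
    refine (norm_inv_smul_sub_le (hc1 ▸ hgn i c y) (hc1 ▸ hgn i c z)).trans ?_
    rw [← dist_eq_norm]
    have := hK.dist_le_mul y z
    push_cast; linarith
  refine (hL.hausdorffMeasure_image_le (Nat.cast_nonneg n) _).trans_lt ?_
  refine ENNReal.mul_lt_top (by finiteness) ?_
  have : (μH[(n : ℝ)] : Measure (Fin n → ℝ)) = volume := by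
    have := hausdorffMeasure_pi_real (ι := Fin n)
    simpa using this
  rw [this]
  exact measure_closedBall_lt_top

theorem exists_saturated_weight {X ι : Type*} (T : Finset X) (I : Finset ι) (A : ι → Set X)
    (b : ι → ℝ) (hb : ∀ i ∈ I, 0 ≤ b i) (hcov : ∀ x ∈ T, ∃ i ∈ I, x ∈ A i) :
    ∃ w : X → ℝ, (∀ x, 0 ≤ w x) ∧ (∀ i ∈ I, ∑ x ∈ T, (A i).indicator w x ≤ b i) ∧
      ∀ x ∈ T, ∃ i ∈ I, x ∈ A i ∧ ∑ x ∈ T, (A i).indicator w x = b i := by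
  classical
  suffices h : ∀ S ⊆ T, ∃ w : X → ℝ, (∀ x, 0 ≤ w x) ∧
      (∀ i ∈ I, ∑ x ∈ T, (A i).indicator w x ≤ b i) ∧
      ∀ x ∈ S, ∃ i ∈ I, x ∈ A i ∧ ∑ x ∈ T, (A i).indicator w x = b i from h T subset_rfl
  intro S
  induction S using Finset.induction_on with
  | empty => exact fun _ => ⟨0, fun _ => le_rfl, fun i hi => by simpa using hb i hi, by simp⟩
  | insert a S haS ih =>
    intro hST
    obtain ⟨w, hw0, hwI, hwS⟩ := ih ((Finset.subset_insert a S).trans hST)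
    have haT : a ∈ T := hST (Finset.mem_insert_self a S)
    obtain ⟨i₀, hi₀, hai₀⟩ := hcov a haT
    obtain ⟨j, hj, hjmin⟩ := Finset.exists_min_image (I.filter (fun i => a ∈ A i))
      (fun i => b i - ∑ x ∈ T, (A i).indicator w x) ⟨i₀, by simp [hi₀, hai₀]⟩
    set δ := b j - ∑ x ∈ T, (A j).indicator w x with hδ
    simp only [Finset.mem_filter] at hj hjmin
    have hδ0 : 0 ≤ δ := sub_nonneg.2 (hwI j hj.1)
    have hsum : ∀ i, ∑ x ∈ T, (A i).indicator (fun x => w x + if x = a then δ else 0) x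
        = ∑ x ∈ T, (A i).indicator w x + if a ∈ A i then δ else 0 := by
      intro i
      have : ∀ x ∈ T, (A i).indicator (fun x => w x + if x = a then δ else 0) x
          = (A i).indicator w x + if x = a then (if a ∈ A i then δ else 0) else 0 := by
        intro x _
        by_cases hx : x ∈ A i <;> by_cases hxa : x = a <;> simp_all
      rw [Finset.sum_congr rfl this, Finset.sum_add_distrib, Finset.sum_ite_eq' T a]
      simp [haT]
    have hnew : ∀ i ∈ I, ∑ x ∈ T, (A i).indicator (fun x => w x + if x = a then δ else 0) x
        ≤ b i := by
      intro i hi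
      rw [hsum]
      split_ifs with h
      · linarith [hjmin i ⟨hi, h⟩]
      · simpa using hwI i hi
    refine ⟨_, fun x => ?_, hnew, fun x hx => ?_⟩
    · have := hw0 x
      split_ifs <;> linarith
    · rcases Finset.mem_insert.1 hx with rfl | hx
      · refine ⟨j, hj.1, hj.2, ?_⟩
        rw [hsum, if_pos hj.2, hδ]; ring
      · obtain ⟨i, hi, hxi, hs⟩ := hwS x hx
        refine ⟨i, hi, hxi, le_antisymm (hnew i hi) ?_⟩
        rw [hsum, ← hs]
        split_ifs <;> linarith

/-- The `α`-dimensional Hausdorff content. -/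
noncomputable def hausdorffContent {X : Type*} [PseudoEMetricSpace X] (α : ℝ) (hα : 0 < α) :
    OuterMeasure X :=
  OuterMeasure.ofFunction (fun s : Set X => ediam s ^ α) (by simp [hα])

theorem hausdorffContent_le {X : Type*} [PseudoEMetricSpace X] {α : ℝ} (hα : 0 < α) (s : Set X) :
    hausdorffContent α hα s ≤ ediam s ^ α :=
  OuterMeasure.ofFunction_le s

theorem hausdorffMeasure_eq_zero_of_content {X : Type*} [EMetricSpace X] [MeasurableSpace X]
    [BorelSpace X] {α : ℝ} (hα : 0 < α) {s : Set X} (h : hausdorffContent α hα s = 0) :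
    μH[α] s = 0 := by
  have key : ∀ n : ℕ, ∃ t : ℕ → Set X, s ⊆ ⋃ i, t i ∧
      ∑' i, ediam (t i) ^ α ≤ ((n : ℝ≥0∞) + 1)⁻¹ := by
    intro n
    have hlt : hausdorffContent α hα s < ((n : ℝ≥0∞) + 1)⁻¹ := by
      rw [h]; simp
    rw [hausdorffContent, OuterMeasure.ofFunction_apply] at hlt
    simp only [iInf_lt_iff] at hlt
    obtain ⟨t, ht, htlt⟩ := hlt
    exact ⟨t, ht, htlt.le⟩
  choose t hts htsum using key
  have hlim : Tendsto (fun n : ℕ => ((n : ℝ≥0∞) + 1)⁻¹) atTop (𝓝 0) := by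
    have := (tendsto_add_atTop_iff_nat 1).2 ENNReal.tendsto_inv_nat_nhds_zero
    simpa using this
  have hlim' : Tendsto (fun n : ℕ => (((n : ℝ≥0∞) + 1)⁻¹) ^ α⁻¹) atTop (𝓝 0) := by
    have := (ENNReal.continuous_rpow_const (y := α⁻¹)).tendsto 0 |>.comp hlim
    simpa [Function.comp_def, hα, ENNReal.zero_rpow_of_pos] using this
  refine le_antisymm ?_ zero_le
  refine (Measure.hausdorffMeasure_le_liminf_tsum α s _ hlim' t
    (Eventually.of_forall fun n i => ?_) (Eventually.of_forall hts)).trans ?_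
  · rw [ENNReal.le_rpow_inv_iff hα]
    exact (ENNReal.le_tsum i).trans (htsum n)
  · refine (liminf_le_liminf (Eventually.of_forall htsum)).trans ?_
    rw [hlim.liminf_eq]

/-- Dyadic ball bounds for a discrete weight give bounds for balls of all radii above the
finest scale. -/
theorem sum_weight_ball_le {X : Type*} [PseudoMetricSpace X] {α : ℝ} (hα : 0 < α) {n : ℕ}
    (T : Finset X) (hT : ∀ x ∈ T, ∀ y ∈ T, dist x y ≤ 1) (w : X → ℝ) (hw : ∀ x, 0 ≤ w x)
    (hI : ∀ p ∈ T, ∀ m ≤ n,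
      ∑ x ∈ T, (closedBall p ((1 / 2 : ℝ) ^ m)).indicator w x ≤ ((1 / 2 : ℝ) ^ m) ^ α)
    (x : X) {ρ : ℝ} (hρ : (1 / 2 : ℝ) ^ n ≤ ρ) :
    ∑ y ∈ T, (ball x ρ).indicator w y ≤ (4 * ρ) ^ α := by
  have hρ0 : 0 < ρ := lt_of_lt_of_le (by positivity) hρ
  by_cases hex : ∃ p ∈ T, p ∈ ball x ρ
  · obtain ⟨p, hpT, hp⟩ := hex
    by_cases h1 : 1 ≤ 2 * ρ
    · calc ∑ y ∈ T, (ball x ρ).indicator w y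
          ≤ ∑ y ∈ T, (closedBall p ((1 / 2 : ℝ) ^ 0)).indicator w y := by
            refine Finset.sum_le_sum fun y hy => ?_
            rw [indicator_of_mem (s := closedBall p _)]
            · exact indicator_le_self' (fun _ _ => hw _) _
            · simpa using hT y hy p hpT
        _ ≤ ((1 / 2 : ℝ) ^ 0) ^ α := hI p hpT 0 (Nat.zero_le _)
        _ ≤ (4 * ρ) ^ α := by
            refine Real.rpow_le_rpow (by positivity) ?_ hα.le
            rw [pow_zero]; linarith
    · push Not at h1
      obtain ⟨m, hm1, hm2⟩ := exists_nat_pow_near_of_lt_one (x := 2 * ρ) (y := (1 / 2 : ℝ))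
        (by positivity) h1.le (by norm_num) (by norm_num)
      have hmn : m ≤ n := by
        by_contra hlt
        push Not at hlt
        have : (1 / 2 : ℝ) ^ m ≤ (1 / 2 : ℝ) ^ n :=
          pow_le_pow_of_le_one (by norm_num) (by norm_num) hlt.le
        linarith
      calc ∑ y ∈ T, (ball x ρ).indicator w y
          ≤ ∑ y ∈ T, (closedBall p ((1 / 2 : ℝ) ^ m)).indicator w y := by
            refine Finset.sum_le_sum fun y hy => ?_
            refine indicator_le_indicator_of_subset (fun z hz => ?_) (fun _ => hw _) y
            rw [mem_closedBall]
            rw [mem_ball] at hz hp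
            linarith [dist_triangle_right z p x]
        _ ≤ ((1 / 2 : ℝ) ^ m) ^ α := hI p hpT m hmn
        _ ≤ (4 * ρ) ^ α := by
            refine Real.rpow_le_rpow (by positivity) ?_ hα.le
            rw [pow_succ] at hm1; linarith
  · push Not at hex
    rw [Finset.sum_eq_zero fun y hy => indicator_of_notMem (hex y hy) w]
    positivity

/-- A discrete Frostman lemma for nets. -/
theorem exists_frostman_weight {X : Type*} [PseudoMetricSpace X] {α : ℝ} (hα : 0 < α) (n : ℕ)
    (S : Set X) (T : Finset X) (hT : ∀ x ∈ T, ∀ y ∈ T, dist x y ≤ 1)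
    (hST : S ⊆ ⋃ p ∈ T, closedBall p ((1 / 2 : ℝ) ^ n)) :
    ∃ w : X → ℝ, (∀ x, 0 ≤ w x) ∧
      (∀ x, ∀ ρ : ℝ, (1 / 2 : ℝ) ^ n ≤ ρ →
        ∑ y ∈ T, (ball x ρ).indicator w y ≤ (4 * ρ) ^ α) ∧
      hausdorffContent α hα S ≤ ENNReal.ofReal (12 ^ α * ∑ y ∈ T, w y) := by
  classical
  let I : Finset (X × ℕ) := T ×ˢ Finset.range (n + 1)
  let A : X × ℕ → Set X := fun i => closedBall i.1 ((1 / 2 : ℝ) ^ i.2)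
  obtain ⟨w, hw0, hwI, hwsat⟩ := exists_saturated_weight T I A
    (fun i => ((1 / 2 : ℝ) ^ i.2) ^ α) (fun i _ => by positivity)
    (fun x hx => ⟨(x, 0), by simp [I, hx], by simp [A]⟩)
  refine ⟨w, hw0, fun x ρ hρ => sum_weight_ball_le hα T hT w hw0 (fun p hp m hm => ?_) x hρ, ?_⟩
  · exact hwI (p, m) (by simp [I, hp]; omega)
  obtain ⟨u, hu, hdisj, hucov⟩ := Vitali.exists_disjoint_subfamily_covering_enlargement_closedBall
    {i : X × ℕ | i ∈ I ∧ ∑ x ∈ T, (A i).indicator w x = ((1 / 2 : ℝ) ^ i.2) ^ α}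
    (fun i => i.1) (fun i => (1 / 2 : ℝ) ^ i.2) 1
    (fun i _ => pow_le_one₀ (by norm_num) (by norm_num)) 5 (by norm_num)
  have hufin : u.Finite := I.finite_toSet.subset fun i hi => (hu hi).1
  lift u to Finset (X × ℕ) using hufin
  have hcov : S ⊆ ⋃ i ∈ u, closedBall i.1 (6 * (1 / 2 : ℝ) ^ i.2) := by
    intro x hx
    obtain ⟨p, hp⟩ := mem_iUnion.1 (hST hx)
    obtain ⟨hpT, hxp⟩ := mem_iUnion.1 hp
    obtain ⟨i, hi, hpi, hsat⟩ := hwsat p hpT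
    obtain ⟨j, hj, hij⟩ := hucov i ⟨hi, hsat⟩
    simp only [mem_iUnion]
    refine ⟨j, by simpa using hj, ?_⟩
    have h1 := hij hpi
    have h2 : j.2 ≤ n := by
      have := (hu hj).1
      simp only [I, Finset.mem_product, Finset.mem_range] at this
      omega
    have h3 : (1 / 2 : ℝ) ^ n ≤ (1 / 2 : ℝ) ^ j.2 :=
      pow_le_pow_of_le_one (by norm_num) (by norm_num) h2
    rw [mem_closedBall] at *
    linarith [dist_triangle x p j.1]
  calc hausdorffContent α hα S
      ≤ ∑ i ∈ u, hausdorffContent α hα (closedBall i.1 (6 * (1 / 2 : ℝ) ^ i.2)) :=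
        (measure_mono hcov).trans (measure_biUnion_finset_le _ _)
    _ ≤ ∑ i ∈ u, ENNReal.ofReal (12 ^ α * ∑ x ∈ T, (A i).indicator w x) := by
        refine Finset.sum_le_sum fun i hi => (hausdorffContent_le hα _).trans ?_
        rw [(hu hi).2, ← Real.mul_rpow (by norm_num) (by positivity),
          ← ENNReal.ofReal_rpow_of_nonneg (by positivity) hα.le]
        refine ENNReal.rpow_le_rpow (ediam_le_of_forall_dist_le fun x hx y hy => ?_) hα.le
        rw [mem_closedBall] at hx hy
        linarith [dist_triangle_right x y i.1]
    _ = ENNReal.ofReal (12 ^ α * ∑ x ∈ T, ∑ i ∈ u, (A i).indicator w x) := by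
        rw [← ENNReal.ofReal_sum_of_nonneg, ← Finset.mul_sum, Finset.sum_comm]
        intro i _
        exact mul_nonneg (by positivity)
          (Finset.sum_nonneg fun x _ => indicator_nonneg (fun _ _ => hw0 _) _)
    _ ≤ _ := by
        gcongr with x hx
        by_cases hex : ∃ i ∈ u, x ∈ A i
        · obtain ⟨i, hi, hxi⟩ := hex
          rw [Finset.sum_eq_single_of_mem i hi, indicator_of_mem hxi]
          intro j hj hji
          refine indicator_of_notMem (fun hxj => ?_) w
          exact Set.disjoint_left.1
            (hdisj (Finset.mem_coe.2 hj) (Finset.mem_coe.2 hi) hji) hxj hxi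
        · push Not at hex
          rw [Finset.sum_eq_zero fun i hi => indicator_of_notMem (hex i hi) w]
          exact hw0 x

/-- A set in a ball of radius `1/2` carries, up to an arbitrarily small enlargement, an
`α`-dimensional measure with mass comparable to the Hausdorff content. -/
theorem exists_frostman_measure (d : ℕ) {α : ℝ} (hα : 0 < α) (hαd : α ≤ d) :
    ∃ C₁ C₂ : ℝ≥0, ∀ S ⊆ closedBall (0 : Euc d) (1 / 2), ∀ δ : ℝ, 0 < δ →
      ∃ ν : Measure (Euc d), IsFiniteMeasure ν ∧ ν (thickening δ S)ᶜ = 0 ∧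
        ν (closedBall 0 1)ᶜ = 0 ∧ cAlpha d α ν ≤ C₁ ∧
        hausdorffContent α hα S ≤ C₂ * ν univ := by
  set V : ℝ≥0 := (volume (ball (0 : Euc d) 1)).toNNReal
  have hV : (V : ℝ≥0∞) = volume (ball (0 : Euc d) 1) :=
    ENNReal.coe_toNNReal measure_ball_lt_top.ne
  have hV0 : (V : ℝ≥0∞) ≠ 0 := by
    rw [hV]; exact (measure_ball_pos _ _ one_pos).ne'
  refine ⟨V * Real.toNNReal (8 ^ α), Real.toNNReal (12 ^ α) * V⁻¹, ?_⟩
  intro S hS δ hδ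
  obtain ⟨n, hn⟩ := exists_pow_lt_of_lt_one (lt_min hδ (by norm_num : (0 : ℝ) < 1 / 2))
    (by norm_num : (1 / 2 : ℝ) < 1)
  set ε : ℝ := (1 / 2 : ℝ) ^ n with hε
  have hε0 : 0 < ε := by positivity
  have hεδ : ε < δ := hn.trans_le (min_le_left _ _)
  have hε2 : ε < 1 / 2 := hn.trans_le (min_le_right _ _)
  obtain ⟨T, hTS, hSTt⟩ : ∃ T : Finset (Euc d), (T : Set (Euc d)) ⊆ S ∧
      S ⊆ ⋃ p ∈ T, closedBall p ε := by
    have htb : TotallyBounded S :=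
      (isCompact_closedBall (0 : Euc d) (1 / 2)).totallyBounded.subset hS
    obtain ⟨t, htS, htf, ht⟩ := finite_approx_of_totallyBounded htb ε hε0
    lift t to Finset (Euc d) using htf
    exact ⟨t, htS, ht.trans (iUnion₂_mono fun p _ => ball_subset_closedBall)⟩
  obtain ⟨w, hw0, hwball, hcont⟩ := exists_frostman_weight hα n S T
    (fun x hx y hy => by
      have h1 := mem_closedBall.1 (hS (hTS hx))
      have h2 := mem_closedBall.1 (hS (hTS hy))
      linarith [dist_triangle_right x y 0]) hSTt
  set c : ℝ≥0∞ := ENNReal.ofReal (ε ^ d) with hc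
  have hc0 : c ≠ 0 := by simp only [hc, ne_eq, ENNReal.ofReal_eq_zero, not_le]; positivity
  have hct : c ≠ ⊤ := ENNReal.ofReal_ne_top
  let ν : Measure (Euc d) :=
    ∑ p ∈ T, (ENNReal.ofReal (w p) * c⁻¹) • volume.restrict (ball p ε)
  have hν : ∀ B, MeasurableSet B →
      ν B = ∑ p ∈ T, ENNReal.ofReal (w p) * c⁻¹ * volume (B ∩ ball p ε) := by
    intro B hB
    simp only [ν, Measure.coe_finsetSum, Finset.sum_apply, Measure.smul_apply, smul_eq_mul,
      Measure.restrict_apply hB]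
  have hvol : ∀ (x : Euc d) (r : ℝ), 0 < r → volume (ball x r) = ENNReal.ofReal (r ^ d) * V := by
    intro x r hr
    rw [hV, Measure.addHaar_ball_of_pos volume x hr]; simp
  have hnull : ∀ B, MeasurableSet B → (∀ p ∈ T, ball p ε ⊆ Bᶜ) → ν B = 0 := by
    intro B hB h
    rw [hν B hB]
    refine Finset.sum_eq_zero fun p hp => ?_
    have : B ∩ ball p ε = ∅ :=
      (Set.disjoint_left.2 fun x hx hx' => h p hp hx' hx).inter_eq
    rw [this]; simp
  have huniv : ν univ = ENNReal.ofReal (∑ p ∈ T, w p) * V := by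
    rw [hν _ .univ, ENNReal.ofReal_sum_of_nonneg fun p _ => hw0 p, Finset.sum_mul]
    refine Finset.sum_congr rfl fun p _ => ?_
    rw [univ_inter, hvol p ε hε0, mul_assoc, ← mul_assoc c⁻¹, ENNReal.inv_mul_cancel hc0 hct,
      one_mul]
  refine ⟨ν, ⟨?_⟩, ?_, ?_, ?_, ?_⟩
  · rw [huniv]; finiteness
  · refine hnull _ isOpen_thickening.measurableSet.compl fun p hp => ?_
    rw [compl_compl]
    exact (ball_subset_ball hεδ.le).trans (ball_subset_thickening (hTS hp) δ)
  · refine hnull _ isClosed_closedBall.measurableSet.compl fun p hp => ?_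
    rw [compl_compl]
    intro x hx
    have h1 := mem_closedBall.1 (hS (hTS hp))
    rw [mem_ball] at hx
    rw [mem_closedBall]
    linarith [dist_triangle x p 0]
  · refine iSup_le fun x => iSup_le fun r => iSup_le fun hr => ?_
    refine ENNReal.div_le_of_le_mul ?_
    have hgen : ∀ ρ : ℝ, ε ≤ ρ → r ≤ ρ → ∀ v : ℝ, 0 ≤ v →
        (∀ p, volume (ball x r ∩ ball p ε) ≤ ENNReal.ofReal v * V) →
        v * (8 * ρ) ^ α ≤ 8 ^ α * r ^ α * ε ^ d →
        ν (ball x r) ≤ ↑(V * Real.toNNReal (8 ^ α)) * ENNReal.ofReal (r ^ α) := by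
      intro ρ hερ hrρ v hv hvp hvr
      calc ν (ball x r)
          ≤ ∑ p ∈ T, ENNReal.ofReal ((ball x (2 * ρ)).indicator w p) * (c⁻¹ *
              (ENNReal.ofReal v * V)) := by
            rw [hν _ measurableSet_ball]
            refine Finset.sum_le_sum fun p _ => ?_
            by_cases hp : p ∈ ball x (2 * ρ)
            · rw [indicator_of_mem hp, mul_assoc]
              gcongr
              exact hvp p
            · have : ball x r ∩ ball p ε = ∅ := by
                refine (Set.disjoint_left.2 fun y hy hy' => hp ?_).inter_eq
                rw [mem_ball] at *
                linarith [dist_triangle_left p x y]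
              rw [this]; simp
        _ = ENNReal.ofReal (∑ p ∈ T, (ball x (2 * ρ)).indicator w p) * (c⁻¹ *
              (ENNReal.ofReal v * V)) := by
            rw [← Finset.sum_mul, ENNReal.ofReal_sum_of_nonneg]
            exact fun p _ => indicator_nonneg (fun _ _ => hw0 _) _
        _ ≤ ENNReal.ofReal ((8 * ρ) ^ α) * (c⁻¹ * (ENNReal.ofReal v * V)) := by
            gcongr
            refine (hwball x (2 * ρ) (by linarith)).trans (le_of_eq ?_)
            ring_nf
        _ = c⁻¹ * (ENNReal.ofReal (v * (8 * ρ) ^ α) * V) := by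
            rw [ENNReal.ofReal_mul hv]; ring
        _ ≤ c⁻¹ * (ENNReal.ofReal (8 ^ α * r ^ α * ε ^ d) * V) := by gcongr
        _ = _ := by
            rw [ENNReal.ofReal_mul (by positivity), ENNReal.ofReal_mul (by positivity), ← hc]
            push_cast
            rw [show ((Real.toNNReal (8 ^ α) : ℝ≥0) : ℝ≥0∞) = ENNReal.ofReal (8 ^ α) from rfl]
            calc _ = (c⁻¹ * c) * (V * ENNReal.ofReal (8 ^ α) * ENNReal.ofReal (r ^ α)) := by ring
              _ = _ := by rw [ENNReal.inv_mul_cancel hc0 hct, one_mul]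
    rcases le_total ε r with h | h
    · refine hgen r h le_rfl (ε ^ d) (by positivity) (fun p => ?_) (le_of_eq ?_)
      · rw [← hvol p ε hε0]; exact measure_mono inter_subset_right
      · rw [Real.mul_rpow (by norm_num) hr.le]; ring
    · refine hgen ε le_rfl h (r ^ d) (by positivity) (fun p => ?_) ?_
      · rw [← hvol x r hr]; exact measure_mono inter_subset_left
      · rw [Real.mul_rpow (by norm_num) hε0.le]
        have h1 : r ^ d * ε ^ α ≤ r ^ α * ε ^ d := by
          rw [← Real.rpow_natCast, ← Real.rpow_natCast]
          have e1 : r ^ (d : ℝ) = r ^ α * r ^ ((d : ℝ) - α) := by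
            rw [← Real.rpow_add hr]; ring_nf
          have e2 : ε ^ (d : ℝ) = ε ^ α * ε ^ ((d : ℝ) - α) := by
            rw [← Real.rpow_add hε0]; ring_nf
          rw [e1, e2]
          have : r ^ ((d : ℝ) - α) ≤ ε ^ ((d : ℝ) - α) :=
            Real.rpow_le_rpow hr.le h (by linarith)
          calc r ^ α * r ^ ((d : ℝ) - α) * ε ^ α
              ≤ r ^ α * ε ^ ((d : ℝ) - α) * ε ^ α := by gcongr
            _ = _ := by ring
        have h2 : (0 : ℝ) ≤ 8 ^ α := by positivity
        nlinarith
  · refine hcont.trans (le_of_eq ?_)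
    rw [huniv, ENNReal.ofReal_mul (by positivity), ENNReal.coe_mul,
      ENNReal.coe_inv (by simpa using hV0)]
    rw [show ((Real.toNNReal (12 ^ α) : ℝ≥0) : ℝ≥0∞) = ENNReal.ofReal (12 ^ α) from rfl]
    calc _ = ENNReal.ofReal (12 ^ α) * ENNReal.ofReal (∑ y ∈ T, w y) * ((V : ℝ≥0∞)⁻¹ * V) := by
          rw [ENNReal.inv_mul_cancel hV0 ENNReal.coe_ne_top, mul_one]
      _ = _ := by ring

/-- The unit sphere of `ℝ^(n+1)` as a type. -/
abbrev USphere (n : ℕ) := sphere (0 : Euc (n + 1)) 1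

/-- Surface measure on the unit sphere of `ℝ^(n+1)`. -/
noncomputable abbrev surf (n : ℕ) : Measure (USphere n) :=
  (volume : Measure (Euc (n + 1))).toSphere

/-- The radial measure `r ^ n dr` on `(0, ∞)`. -/
noncomputable abbrev radial (n : ℕ) : Measure (Ioi (0 : ℝ)) := Measure.volumeIoiPow n

/-- Polar coordinates. -/
def polar (n : ℕ) (p : USphere n × Ioi (0 : ℝ)) : Euc (n + 1) := p.2.1 • p.1.1

theorem continuous_polar (n : ℕ) : Continuous (polar n) := by unfold polar; fun_prop

theorem norm_polar (n : ℕ) (p : USphere n × Ioi (0 : ℝ)) : ‖polar n p‖ = p.2.1 := by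
  simp [polar, norm_smul, abs_of_pos (mem_Ioi.1 p.2.2)]

theorem map_polar (n : ℕ) :
    Measure.map (polar n) ((surf n).prod (radial n)) = volume := by
  have h := (volume : Measure (Euc (n + 1))).measurePreserving_homeomorphUnitSphereProd
  have hfin : Module.finrank ℝ (Euc (n + 1)) - 1 = n := by simp
  rw [hfin] at h
  have h2 := MeasurePreserving.symm (homeomorphUnitSphereProd (Euc (n + 1))).toMeasurableEquiv h
  have h3 : polar n = Subtype.val ∘ (homeomorphUnitSphereProd (Euc (n + 1))).symm := by
    ext1 p; simp [polar]
  have hm : MeasurableSet ({0}ᶜ : Set (Euc (n + 1))) := (measurableSet_singleton _).compl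
  rw [h3, ← Measure.map_map measurable_subtype_coe
    (homeomorphUnitSphereProd (Euc (n + 1))).symm.measurable]
  have h4 := h2.map_eq
  simp only [Homeomorph.toMeasurableEquiv_symm_coe] at h4
  rw [h4, map_comap_subtype_coe hm, restrict_compl_singleton]

theorem measurePreserving_polar (n : ℕ) :
    MeasurePreserving (polar n) ((surf n).prod (radial n)) volume :=
  ⟨(continuous_polar n).measurable, map_polar n⟩

theorem lintegral_polar (n : ℕ) {Φ : Euc (n + 1) → ℝ≥0∞} (hΦ : Measurable Φ) :
    ∫⁻ ξ, Φ ξ = ∫⁻ r, ∫⁻ ω, Φ (polar n (ω, r)) ∂surf n ∂radial n := by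
  rw [← (measurePreserving_polar n).lintegral_comp hΦ, lintegral_prod_symm]
  exact (hΦ.comp (continuous_polar n).measurable).aemeasurable

theorem integral_polar (n : ℕ) {Φ : Euc (n + 1) → ℂ} (hΦ : Integrable Φ) :
    ∫ ξ, Φ ξ = ∫ r, ∫ ω, Φ (polar n (ω, r)) ∂surf n ∂radial n := by
  have h := (measurePreserving_polar n).integrable_comp_of_integrable hΦ
  have h2 := integral_prod_symm _ h
  simp only [Function.comp_apply] at h2
  rw [← h2]
  conv_lhs => rw [← map_polar n]
  refine integral_map (continuous_polar n).aemeasurable ?_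
  rw [map_polar n]; exact hΦ.1

theorem cAlpha_mono {d : ℕ} {α : ℝ} {μ ν : Measure (Euc d)} (h : μ ≤ ν) :
    cAlpha d α μ ≤ cAlpha d α ν := by
  unfold cAlpha
  gcongr

theorem norm_fourierMeasure {d : ℕ} (μ : Measure (Euc d)) (ξ : Euc d) :
    ‖fourierMeasure μ ξ‖ = (2 * Real.pi) ^ (-(d : ℝ) / 2) * ‖charFun μ ξ‖ := by
  have h0 : (0 : ℝ) ≤ (2 * Real.pi) ^ (-(d : ℝ) / 2) := by positivity
  have h1 : ‖charFun μ ξ‖ = ‖charFun μ (-ξ)‖ := by rw [charFun_neg, RCLike.norm_conj]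
  rw [fourierMeasure, norm_mul, Complex.norm_real, Real.norm_of_nonneg h0, h1, charFun_apply]
  congr 3
  ext x
  congr 1
  simp [inner_neg_right, mul_comm]

instance isFiniteMeasure_sphereMeasure_s3 (n : ℕ) : IsFiniteMeasure (sphereMeasure (n + 1)) := by
  refine ⟨?_⟩
  rw [sphereMeasure, Measure.restrict_apply_univ]
  simpa using hausdorff_sphere_lt_top n

/-- Decay of the spherical means of the Fourier transform, for measures whose dimensional
constant is bounded. -/
def SphericalDecay (n : ℕ) (α β : ℝ) (C₁ K : ℝ≥0) : Prop :=
  ∀ ν : Measure (Euc (n + 1)), IsFiniteMeasure ν → ν (closedBall 0 1)ᶜ = 0 →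
    cAlpha (n + 1) α ν ≤ C₁ → ∀ r : Ioi (0 : ℝ), 1 < r.1 →
      ∫⁻ ω, ‖charFun ν (polar n (ω, r))‖ₑ ^ 2 ∂surf n ≤ K * ν univ * ENNReal.ofReal (r.1 ^ (-β))

theorem exists_sphericalDecay {n : ℕ} (hn : 0 < n) {α β C₀ : ℝ}
    (hdecay : ∀ ν : Measure (Euc (n + 1)), IsAlphaDimensional (n + 1) α ν →
      ∀ R : ℝ, 1 < R →
        ∫ ω, ‖fourierMeasure ν (R • ω)‖ ^ 2 ∂(sphereMeasure (n + 1))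
          ≤ C₀ * (cAlpha (n + 1) α ν).toReal * (ν univ).toReal * R ^ (-β)) (C₁ : ℝ≥0) :
    ∃ K : ℝ≥0, SphericalDecay n α β C₁ K := by
  obtain ⟨C, hC⟩ := exists_map_toSphere_le_hausdorff n hn
  set c : ℝ := (2 * Real.pi) ^ (-((n + 1 : ℕ) : ℝ) / 2) with hc
  have hc0 : 0 < c := by positivity
  refine ⟨C * Real.toNNReal ((c ^ 2)⁻¹ * (|C₀| * C₁)), ?_⟩
  intro ν hν hsupp hcα r hr
  have hmeas : Measurable fun y : Euc (n + 1) => ‖charFun ν (r.1 • y)‖ₑ ^ 2 := by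
    have h1 : Measurable (charFun ν) := measurable_charFun
    exact (h1.comp (measurable_const_smul r.1)).enorm.pow_const 2
  have hdec := hdecay ν ⟨hsupp, (hcα.trans_lt ENNReal.coe_lt_top).ne⟩ r.1 hr
  have e1 : ∫ ω, ‖fourierMeasure ν (r.1 • ω)‖ ^ 2 ∂(sphereMeasure (n + 1)) =
      c ^ 2 * ∫ ω, ‖charFun ν (r.1 • ω)‖ ^ 2 ∂(sphereMeasure (n + 1)) := by
    rw [← integral_const_mul]
    congr 1; ext ω
    rw [norm_fourierMeasure, mul_pow]
  have hcA : (cAlpha (n + 1) α ν).toReal ≤ C₁ := ENNReal.toReal_le_coe_of_le_coe hcα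
  have hr0 : (0 : ℝ) ≤ r.1 ^ (-β) := Real.rpow_nonneg (le_of_lt r.2) _
  have e2 : ∫ ω, ‖charFun ν (r.1 • ω)‖ ^ 2 ∂(sphereMeasure (n + 1)) ≤
      (c ^ 2)⁻¹ * (|C₀| * C₁) * (ν univ).toReal * r.1 ^ (-β) := by
    have h3 : c ^ 2 * ∫ ω, ‖charFun ν (r.1 • ω)‖ ^ 2 ∂(sphereMeasure (n + 1)) ≤
        |C₀| * C₁ * (ν univ).toReal * r.1 ^ (-β) := by
      rw [← e1]
      refine hdec.trans ?_
      gcongr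
      exact le_abs_self _
    calc _ = (c ^ 2)⁻¹ * (c ^ 2 * ∫ ω, ‖charFun ν (r.1 • ω)‖ ^ 2 ∂(sphereMeasure (n + 1))) := by
          field_simp
      _ ≤ (c ^ 2)⁻¹ * (|C₀| * C₁ * (ν univ).toReal * r.1 ^ (-β)) := by gcongr
      _ = _ := by ring
  have h_intg : Integrable (fun ω => ‖charFun ν (r.1 • ω)‖ ^ 2) (sphereMeasure (n + 1)) := by
    have h1 : Measurable (charFun ν) := measurable_charFun
    refine Integrable.of_bound
      ((h1.comp (measurable_const_smul r.1)).norm.pow_const 2).aestronglyMeasurable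
      ((ν.real univ) ^ 2) (ae_of_all _ fun ω => ?_)
    rw [norm_pow, norm_norm]
    gcongr
    exact norm_charFun_le _
  calc ∫⁻ ω, ‖charFun ν (polar n (ω, r))‖ₑ ^ 2 ∂surf n
      = ∫⁻ y, ‖charFun ν (r.1 • y)‖ₑ ^ 2 ∂(Measure.map Subtype.val (surf n)) := by
        rw [lintegral_map hmeas measurable_subtype_coe]; rfl
    _ ≤ ∫⁻ y, ‖charFun ν (r.1 • y)‖ₑ ^ 2 ∂((C : ℝ≥0∞) • sphereMeasure (n + 1)) :=
        lintegral_mono' hC le_rfl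
    _ = C * ENNReal.ofReal (∫ ω, ‖charFun ν (r.1 • ω)‖ ^ 2 ∂(sphereMeasure (n + 1))) := by
        rw [lintegral_smul_measure, smul_eq_mul, ofReal_integral_eq_lintegral_ofReal h_intg
          (ae_of_all _ fun ω => by positivity)]
        congr 2; ext ω
        rw [ENNReal.ofReal_pow (norm_nonneg _), ofReal_norm]
    _ ≤ C * ENNReal.ofReal ((c ^ 2)⁻¹ * (|C₀| * C₁) * (ν univ).toReal * r.1 ^ (-β)) := by gcongr
    _ = _ := by
        rw [ENNReal.ofReal_mul (by positivity), ENNReal.ofReal_mul (by positivity),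
          ENNReal.ofReal_toReal (measure_ne_top _ _), ENNReal.coe_mul, ENNReal.ofReal]
        ring

/-- An `L¹` norm is controlled by the integrals over measurable sets. -/
theorem lintegral_enorm_le_of_setIntegral {X : Type*} [MeasurableSpace X] {ν : Measure X}
    {h : X → ℂ} (hh : Integrable h ν) {M : ℝ≥0∞}
    (hM : ∀ A, MeasurableSet A → ‖∫ x in A, h x ∂ν‖ₑ ≤ M) : ∫⁻ x, ‖h x‖ₑ ∂ν ≤ 4 * M := by
  have key : ∀ g : X → ℝ, Integrable g ν →
      (∀ A, MeasurableSet A → ‖∫ x in A, g x ∂ν‖ₑ ≤ M) → ∫⁻ x, ‖g x‖ₑ ∂ν ≤ 2 * M := by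
    intro g hg hgM
    obtain ⟨g', hg'm, hgg'⟩ := hg.1
    have hg' : Integrable g' ν := hg.congr hgg'
    have hcongr : ∫⁻ x, ‖g x‖ₑ ∂ν = ∫⁻ x, ‖g' x‖ₑ ∂ν := lintegral_congr_ae (hgg'.fun_comp enorm)
    rw [hcongr]
    have hA : MeasurableSet {x | 0 ≤ g' x} := measurableSet_le measurable_const hg'm.measurable
    have hpos := hgM _ hA
    have hneg := hgM _ hA.compl
    rw [integral_congr_ae (ae_restrict_of_ae hgg')] at hpos hneg
    rw [← lintegral_add_compl _ hA, two_mul]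
    refine add_le_add (le_trans (le_of_eq ?_) hpos) (le_trans (le_of_eq ?_) hneg)
    · rw [Real.enorm_of_nonneg (setIntegral_nonneg hA fun x hx => hx),
        ofReal_integral_eq_lintegral_ofReal hg'.integrableOn]
      · exact setLIntegral_congr_fun hA fun x hx => Real.enorm_of_nonneg hx
      · exact (ae_restrict_iff' hA).2 (ae_of_all _ fun x hx => hx)
    · rw [← enorm_neg, ← integral_neg, Real.enorm_of_nonneg
        (setIntegral_nonneg hA.compl fun x hx => by simp at hx; linarith),
        ofReal_integral_eq_lintegral_ofReal (f := fun x => -g' x) hg'.neg.integrableOn]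
      · refine setLIntegral_congr_fun hA.compl fun x hx => ?_
        simp at hx
        rw [← Real.enorm_of_nonneg (by linarith), enorm_neg]
      · refine (ae_restrict_iff' hA.compl).2 (ae_of_all _ fun x hx => ?_)
        simp at hx; simp; linarith
  have h1 := key (fun x => (h x).re) hh.re fun A hA => by
    have : ∫ x in A, (h x).re ∂ν = (∫ x in A, h x ∂ν).re := integral_re (𝕜 := ℂ) hh.integrableOn
    rw [this]
    refine le_trans ?_ (hM A hA)
    rw [← ofReal_norm, ← ofReal_norm]
    exact ENNReal.ofReal_le_ofReal (Complex.abs_re_le_norm _)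
  have h2 := key (fun x => (h x).im) hh.im fun A hA => by
    have : ∫ x in A, (h x).im ∂ν = (∫ x in A, h x ∂ν).im := integral_im (𝕜 := ℂ) hh.integrableOn
    rw [this]
    refine le_trans ?_ (hM A hA)
    rw [← ofReal_norm, ← ofReal_norm]
    exact ENNReal.ofReal_le_ofReal (Complex.abs_im_le_norm _)
  calc ∫⁻ x, ‖h x‖ₑ ∂ν ≤ ∫⁻ x, (‖(h x).re‖ₑ + ‖(h x).im‖ₑ) ∂ν := by
        refine lintegral_mono fun x => ?_
        rw [← ofReal_norm, ← ofReal_norm, ← ofReal_norm,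
          ← ENNReal.ofReal_add (norm_nonneg _) (norm_nonneg _)]
        exact ENNReal.ofReal_le_ofReal (Complex.norm_le_abs_re_add_abs_im _)
    _ = _ := lintegral_add_left' hh.1.re.enorm _
    _ ≤ 2 * M + 2 * M := add_le_add h1 h2
    _ = 4 * M := by ring

/-- The spherical part at frequency `r` of the Fourier integral of `f` at the point `x`. -/
noncomputable def profile (n : ℕ) (f : Euc (n + 1) → ℂ) (x : Euc (n + 1)) (r : Ioi (0 : ℝ)) : ℂ :=
  ∫ ω, f (polar n (ω, r)) * Complex.exp ((⟪x, polar n (ω, r)⟫_ℝ : ℝ) * Complex.I) ∂surf n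

theorem ENNReal.mul_le_weighted_sq_add {θ : ℝ≥0∞} (h0 : θ ≠ 0) (ht : θ ≠ ⊤) (a b : ℝ≥0∞) :
    a * b ≤ θ * a ^ 2 + θ⁻¹ * b ^ 2 := by
  rcases le_total b (θ * a) with h | h
  · calc a * b ≤ a * (θ * a) := by gcongr
      _ = θ * a ^ 2 := by ring
      _ ≤ _ := le_self_add
  · calc a * b = θ⁻¹ * (θ * a) * b := by
          rw [← mul_assoc, ENNReal.inv_mul_cancel h0 ht, one_mul]
      _ ≤ θ⁻¹ * b * b := by gcongr
      _ = θ⁻¹ * b ^ 2 := by ring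
      _ ≤ _ := le_add_self

theorem measurable_profile (n : ℕ) {f : Euc (n + 1) → ℂ} (hf : Measurable f) :
    Measurable fun p : Euc (n + 1) × Ioi (0 : ℝ) => profile n f p.1 p.2 := by
  have hp : Measurable (polar n) := (continuous_polar n).measurable
  have h2 : Measurable fun q : (Euc (n + 1) × Ioi (0 : ℝ)) × USphere n => polar n (q.2, q.1.2) :=
    hp.comp (by fun_prop)
  have h3 : Measurable fun q : (Euc (n + 1) × Ioi (0 : ℝ)) × USphere n =>
      f (polar n (q.2, q.1.2)) *
        Complex.exp ((⟪q.1.1, polar n (q.2, q.1.2)⟫_ℝ : ℝ) * Complex.I) := by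
    refine (hf.comp h2).mul ?_
    have h4 : Measurable fun q : (Euc (n + 1) × Ioi (0 : ℝ)) × USphere n => q.1.1 := by fun_prop
    have h5 := h4.inner (𝕜 := ℝ) h2
    fun_prop
  exact (h3.stronglyMeasurable.integral_prod_right (ν := surf n)).measurable

theorem enorm_exp_ofReal_mul_I (a : ℝ) : ‖Complex.exp (a * Complex.I)‖ₑ = 1 := by
  rw [← ofReal_norm, Complex.norm_exp_ofReal_mul_I]; simp

theorem lintegral_enorm_profile_le (n : ℕ) {α β : ℝ} {C₁ K : ℝ≥0}
    (hK : SphericalDecay n α β C₁ K) {f : Euc (n + 1) → ℂ} (hf : Measurable f)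
    (ν : Measure (Euc (n + 1))) [IsFiniteMeasure ν] (hsupp : ν (closedBall 0 1)ᶜ = 0)
    (hα : cAlpha (n + 1) α ν ≤ C₁) (r : Ioi (0 : ℝ)) (hr : 1 < r.1)
    {θ : ℝ≥0∞} (h0 : θ ≠ 0) (ht : θ ≠ ⊤) :
    ∫⁻ x, ‖profile n f x r‖ₑ ∂ν ≤ 4 * (θ * ∫⁻ ω, ‖f (polar n (ω, r))‖ₑ ^ 2 ∂surf n +
      θ⁻¹ * (K * ν univ * ENNReal.ofReal (r.1 ^ (-β)))) := by
  have hp : Measurable (polar n) := (continuous_polar n).measurable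
  have hfr : Measurable fun ω : USphere n => f (polar n (ω, r)) := hf.comp (hp.comp (by fun_prop))
  by_cases hE : ∫⁻ ω, ‖f (polar n (ω, r))‖ₑ ^ 2 ∂surf n = ⊤
  · rw [hE, ENNReal.mul_top h0, top_add, ENNReal.mul_top (by norm_num)]; exact le_top
  have hfi : Integrable (fun ω : USphere n => f (polar n (ω, r))) (surf n) := by
    refine MemLp.integrable (q := 2) (by norm_num) ⟨hfr.aestronglyMeasurable, ?_⟩
    rw [eLpNorm_lt_top_iff_lintegral_rpow_enorm_lt_top (by norm_num) (by norm_num)]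
    simpa using lt_top_iff_ne_top.2 hE
  have hprod : ∀ ν' : Measure (Euc (n + 1)), IsFiniteMeasure ν' →
      Integrable (Function.uncurry fun (x : Euc (n + 1)) (ω : USphere n) => f (polar n (ω, r)) *
        Complex.exp ((⟪x, polar n (ω, r)⟫_ℝ : ℝ) * Complex.I)) (ν'.prod (surf n)) := by
    intro ν' hν'
    have h1 : Integrable (fun q : Euc (n + 1) × USphere n => f (polar n (q.2, r)))
        (ν'.prod (surf n)) := hfi.comp_snd ν'
    refine h1.mul_bdd (c := 1) ?_ (ae_of_all _ fun q => ?_)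
    · have : Continuous fun q : Euc (n + 1) × USphere n =>
          Complex.exp ((⟪q.1, polar n (q.2, r)⟫_ℝ : ℝ) * Complex.I) := by
        have := (continuous_polar n)
        fun_prop
      exact this.aestronglyMeasurable
    · rw [Complex.norm_exp_ofReal_mul_I]
  refine lintegral_enorm_le_of_setIntegral (hprod ν inferInstance).integral_prod_left
    fun A hA => ?_
  have hdec := hK (ν.restrict A) inferInstance
    (le_antisymm ((Measure.restrict_le_self _).trans hsupp.le) zero_le)
    ((cAlpha_mono Measure.restrict_le_self).trans hα) r hr
  have hswap : ∫ x in A, profile n f x r ∂ν =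
      ∫ ω, f (polar n (ω, r)) * charFun (ν.restrict A) (polar n (ω, r)) ∂surf n := by
    unfold profile
    rw [integral_integral_swap (hprod (ν.restrict A) inferInstance)]
    congr 1; ext ω
    rw [integral_const_mul, charFun_apply]
  have hcm : Measurable fun ω : USphere n => charFun (ν.restrict A) (polar n (ω, r)) := by
    have h1 : Measurable (charFun (ν.restrict A)) := measurable_charFun
    exact h1.comp (hp.comp (by fun_prop))
  change ‖∫ x in A, profile n f x r ∂ν‖ₑ ≤ _
  rw [hswap]
  calc _ ≤ ∫⁻ ω, ‖f (polar n (ω, r)) * charFun (ν.restrict A) (polar n (ω, r))‖ₑ ∂surf n :=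
        enorm_integral_le_lintegral_enorm _
    _ ≤ ∫⁻ ω, (θ * ‖f (polar n (ω, r))‖ₑ ^ 2 +
          θ⁻¹ * ‖charFun (ν.restrict A) (polar n (ω, r))‖ₑ ^ 2) ∂surf n := by
        refine lintegral_mono fun ω => ?_
        rw [enorm_mul]
        exact ENNReal.mul_le_weighted_sq_add h0 ht _ _
    _ = θ * ∫⁻ ω, ‖f (polar n (ω, r))‖ₑ ^ 2 ∂surf n +
          θ⁻¹ * ∫⁻ ω, ‖charFun (ν.restrict A) (polar n (ω, r))‖ₑ ^ 2 ∂surf n := by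
        rw [lintegral_add_left ((hfr.enorm.pow_const 2).const_mul θ),
          lintegral_const_mul _ (hfr.enorm.pow_const 2),
          lintegral_const_mul _ (hcm.enorm.pow_const 2)]
    _ ≤ _ := by
        gcongr
        refine hdec.trans ?_
        gcongr
        exact Measure.restrict_le_self

theorem lintegral_radial (n : ℕ) {Φ : ℝ → ℝ≥0∞} (hΦ : Measurable Φ) :
    ∫⁻ r, Φ r.1 ∂radial n = ∫⁻ t in Ioi (0 : ℝ), ENNReal.ofReal (t ^ n) * Φ t := by
  rw [radial, Measure.volumeIoiPow, lintegral_withDensity_eq_lintegral_mul _ (by fun_prop)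
    (g := fun r : Ioi (0 : ℝ) => Φ r.1) (hΦ.comp measurable_subtype_coe)]
  exact lintegral_subtype_comap measurableSet_Ioi fun t : ℝ => ENNReal.ofReal (t ^ n) * Φ t

/-- The weighted energy of `f`, i.e. the square of its `Ḣˢ` norm on the Fourier side. -/
noncomputable def energy (n : ℕ) (s : ℝ) (f : Euc (n + 1) → ℂ) : ℝ≥0∞ :=
  ∫⁻ ξ, ENNReal.ofReal (‖ξ‖ ^ (2 * s)) * ‖f ξ‖ₑ ^ 2

theorem ofReal_rpow_inv {r : ℝ} (hr : 0 < r) (p : ℝ) :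
    (ENNReal.ofReal (r ^ p))⁻¹ = ENNReal.ofReal (r ^ (-p)) := by
  rw [← ENNReal.ofReal_inv_of_pos (Real.rpow_pos_of_pos hr p), Real.rpow_neg hr.le]

theorem lintegral_radial_rpow_lt_top (n : ℕ) {γ : ℝ} (hγ : (n : ℝ) + 1 < γ) {R : ℝ} (hR : 0 < R) :
    ∫⁻ r in {r : Ioi (0 : ℝ) | R < r.1}, ENNReal.ofReal (r.1 ^ (-γ)) ∂radial n < ⊤ := by
  have hm : Measurable ((Ioi R).indicator fun t : ℝ => ENNReal.ofReal (t ^ (-γ))) :=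
    Measurable.indicator (by fun_prop) measurableSet_Ioi
  have h1 : ∫⁻ r in {r : Ioi (0 : ℝ) | R < r.1}, ENNReal.ofReal (r.1 ^ (-γ)) ∂radial n =
      ∫⁻ r, (Ioi R).indicator (fun t : ℝ => ENNReal.ofReal (t ^ (-γ))) r.1 ∂radial n := by
    rw [← lintegral_indicator (measurableSet_lt measurable_const measurable_subtype_coe)]
    rfl
  rw [h1, lintegral_radial n hm]
  have h_intg := integrableOn_Ioi_rpow_of_lt (a := (n : ℝ) - γ) (by linarith) hR
  refine lt_of_le_of_lt ?_ h_intg.hasFiniteIntegral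
  rw [← lintegral_indicator measurableSet_Ioi, ← lintegral_indicator measurableSet_Ioi]
  refine lintegral_mono fun t => ?_
  by_cases ht : t ∈ Ioi R
  · have ht0 : (0 : ℝ) < t := hR.trans ht
    rw [indicator_of_mem (mem_Ioi.2 ht0), indicator_of_mem ht, indicator_of_mem ht,
      ← ENNReal.ofReal_mul (by positivity), ← Real.rpow_natCast, ← Real.rpow_add ht0,
      Real.enorm_of_nonneg (by positivity), sub_eq_add_neg]
  · rw [indicator_of_notMem ht]
    by_cases h0 : t ∈ Ioi (0 : ℝ)
    · rw [indicator_of_mem h0, indicator_of_notMem ht]; simp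
    · rw [indicator_of_notMem h0]

theorem lintegral_weight_mul_lt_top (n : ℕ) {s : ℝ} (hs : 0 < s) (hsn : 2 * s < n + 1)
    {g : ℝ → ℝ} (hg : Measurable g) {C : ℝ} (hC1 : ∀ r, 0 < r → |g r| ≤ C)
    (hC2 : ∀ r, 0 < r → |g r| * r ^ (n + 1) ≤ C)
    {f : Euc (n + 1) → ℂ} (hf : Measurable f) (hA : energy n s f ≠ ⊤) :
    ∫⁻ ξ, ‖g ‖ξ‖‖ₑ * ‖f ξ‖ₑ < ⊤ := by
  have hC0 : 0 ≤ C := (abs_nonneg _).trans (hC1 1 one_pos)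
  have hw : ∫⁻ ξ : Euc (n + 1), ENNReal.ofReal (‖ξ‖ ^ (-(2 * s))) * ‖g ‖ξ‖‖ₑ ^ 2 < ⊤ := by
    have hm : Measurable fun t : ℝ => ENNReal.ofReal (t ^ (-(2 * s))) * ‖g t‖ₑ ^ 2 := by fun_prop
    have hpol := lintegral_polar n (hm.comp measurable_norm)
    simp only [norm_polar, lintegral_const, Function.comp_apply] at hpol
    have hm' : Measurable fun r : Ioi (0 : ℝ) =>
        ENNReal.ofReal (r.1 ^ (-(2 * s))) * ‖g r.1‖ₑ ^ 2 := hm.comp measurable_subtype_coe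
    rw [hpol, lintegral_mul_const _ hm', lintegral_radial n hm]
    refine ENNReal.mul_lt_top ?_ (measure_lt_top _ _)
    have hun : Ioi (0 : ℝ) = Ioc 0 1 ∪ Ioi 1 := (Ioc_union_Ioi_eq_Ioi zero_le_one).symm
    rw [hun]
    refine (lintegral_union_le _ _ _).trans_lt (ENNReal.add_lt_top.2 ⟨?_, ?_⟩)
    · have h_intg : IntegrableOn (fun t : ℝ => C ^ 2 * t ^ ((n : ℝ) - 2 * s)) (Ioc 0 1) := by
        have := (intervalIntegral.intervalIntegrable_rpow' (a := 0) (b := 1)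
          (r := (n : ℝ) - 2 * s) (by linarith)).1
        exact this.const_mul _
      refine lt_of_le_of_lt ?_ h_intg.hasFiniteIntegral
      refine setLIntegral_mono' measurableSet_Ioc fun t ht => ?_
      have ht0 : 0 < t := ht.1
      rw [Real.enorm_eq_ofReal_abs (g t),
        Real.enorm_of_nonneg (show 0 ≤ C ^ 2 * t ^ ((n : ℝ) - 2 * s) by positivity),
        ← ENNReal.ofReal_pow (abs_nonneg _), ← ENNReal.ofReal_mul (by positivity),
        ← ENNReal.ofReal_mul (by positivity)]
      refine ENNReal.ofReal_le_ofReal ?_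
      have e : t ^ ((n : ℝ) - 2 * s) = t ^ n * t ^ (-(2 * s)) := by
        rw [← Real.rpow_natCast, ← Real.rpow_add ht0, sub_eq_add_neg]
      rw [e]
      have := hC1 t ht0
      calc t ^ n * (t ^ (-(2 * s)) * |g t| ^ 2) ≤ t ^ n * (t ^ (-(2 * s)) * C ^ 2) := by gcongr
        _ = _ := by ring
    · have h_intg := (integrableOn_Ioi_rpow_of_lt (a := (-2 : ℝ)) (by norm_num) one_pos).const_mul
        (C ^ 2)
      refine lt_of_le_of_lt ?_ h_intg.hasFiniteIntegral
      refine setLIntegral_mono' measurableSet_Ioi fun t ht => ?_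
      have ht1 : 1 < t := ht
      have ht0 : 0 < t := by linarith
      rw [Real.enorm_eq_ofReal_abs (g t),
        Real.enorm_of_nonneg (show 0 ≤ C ^ 2 * t ^ (-2 : ℝ) by positivity),
        ← ENNReal.ofReal_pow (abs_nonneg _), ← ENNReal.ofReal_mul (by positivity),
        ← ENNReal.ofReal_mul (by positivity)]
      refine ENNReal.ofReal_le_ofReal ?_
      have e : t ^ (-2 : ℝ) = (t ^ 2)⁻¹ := by
        rw [Real.rpow_neg ht0.le]; norm_cast
      have e2 : t ^ (-(2 * s)) ≤ 1 := Real.rpow_le_one_of_one_le_of_nonpos ht1.le (by linarith)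
      rw [e, ← div_eq_mul_inv, le_div_iff₀ (by positivity)]
      have h1 := hC2 t ht0
      calc t ^ n * (t ^ (-(2 * s)) * |g t| ^ 2) * t ^ 2
          ≤ t ^ n * (1 * |g t| ^ 2) * t ^ 2 * t ^ n := by
            have : (1 : ℝ) ≤ t ^ n := one_le_pow₀ ht1.le
            have h3 : t ^ n * (t ^ (-(2 * s)) * |g t| ^ 2) * t ^ 2 ≤
              t ^ n * (1 * |g t| ^ 2) * t ^ 2 := by gcongr
            refine h3.trans (le_mul_of_one_le_right (by positivity) this)
        _ = (|g t| * t ^ (n + 1)) ^ 2 := by ring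
        _ ≤ C ^ 2 := by gcongr
  refine lt_of_le_of_lt (b := ∫⁻ ξ : Euc (n + 1), (ENNReal.ofReal (‖ξ‖ ^ (2 * s)) * ‖f ξ‖ₑ ^ 2 +
    ENNReal.ofReal (‖ξ‖ ^ (-(2 * s))) * ‖g ‖ξ‖‖ₑ ^ 2)) ?_ ?_
  · refine lintegral_mono_ae ?_
    have h0 : ∀ᵐ ξ : Euc (n + 1), ξ ≠ 0 := by
      simp [ae_iff]
    filter_upwards [h0] with ξ hξ
    have hξ' : 0 < ‖ξ‖ := norm_pos_iff.2 hξ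
    rw [mul_comm, ← ofReal_rpow_inv hξ']
    refine ENNReal.mul_le_weighted_sq_add ?_ ENNReal.ofReal_ne_top _ _
    simp only [ne_eq, ENNReal.ofReal_eq_zero, not_le]; positivity
  · rw [lintegral_add_left (by fun_prop)]
    exact ENNReal.add_lt_top.2 ⟨lt_top_iff_ne_top.2 hA, hw⟩

theorem lintegral_ball_lt_top (n : ℕ) {s : ℝ} (hs : 0 < s) (hsn : 2 * s < n + 1)
    {f : Euc (n + 1) → ℂ} (hf : Measurable f) (hA : energy n s f ≠ ⊤) (R : ℝ) :
    ∫⁻ ξ in ball (0 : Euc (n + 1)) R, ‖f ξ‖ₑ < ⊤ := by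
  have h := lintegral_weight_mul_lt_top n hs hsn (g := (Iio R).indicator 1)
    (measurable_one.indicator measurableSet_Iio) (C := max 1 (|R| ^ (n + 1))) ?_ ?_ hf hA
  · refine lt_of_le_of_lt ?_ h
    rw [← lintegral_indicator measurableSet_ball]
    refine lintegral_mono fun ξ => ?_
    by_cases hξ : ξ ∈ ball (0 : Euc (n + 1)) R
    · rw [indicator_of_mem hξ, indicator_of_mem (by simpa using hξ)]; simp
    · rw [indicator_of_notMem hξ]; exact zero_le
  · intro r hr
    refine le_trans ?_ (le_max_left _ _)
    by_cases h : r ∈ Iio R <;> simp [indicator, h]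
  · intro r hr
    refine le_trans ?_ (le_max_right _ _)
    by_cases h : r ∈ Iio R
    · have : r ≤ |R| := (le_of_lt h).trans (le_abs_self _)
      simp only [indicator_of_mem h, Pi.one_apply, abs_one, one_mul]
      gcongr
    · simp only [indicator_of_notMem h, abs_zero, zero_mul]; positivity

theorem measurable_comp_polar (n : ℕ) {f : Euc (n + 1) → ℂ} (hf : Measurable f)
    (r : Ioi (0 : ℝ)) : Measurable fun ω : USphere n => f (polar n (ω, r)) :=
  hf.comp ((continuous_polar n).measurable.comp (by fun_prop))

theorem measurable_sphere_lintegral (n : ℕ) {Φ : Euc (n + 1) → ℝ≥0∞} (hΦ : Measurable Φ) :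
    Measurable fun r : Ioi (0 : ℝ) => ∫⁻ ω, Φ (polar n (ω, r)) ∂surf n :=
  Measurable.lintegral_prod_left' (f := fun p : USphere n × Ioi (0 : ℝ) => Φ (polar n p))
    (hΦ.comp (continuous_polar n).measurable)

theorem lintegral_block_le (n : ℕ) {s α β : ℝ} {C₁ K : ℝ≥0}
    (hK : SphericalDecay n α β C₁ K) {f : Euc (n + 1) → ℂ} (hf : Measurable f)
    (ν : Measure (Euc (n + 1))) [IsFiniteMeasure ν] (hsupp : ν (closedBall 0 1)ᶜ = 0)
    (hα : cAlpha (n + 1) α ν ≤ C₁) {J : Set (Ioi (0 : ℝ))} (hJm : MeasurableSet J)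
    (hJ : ∀ r ∈ J, 1 < r.1) {θ : ℝ≥0∞} (h0 : θ ≠ 0) (ht : θ ≠ ⊤) :
    ∫⁻ x, ∫⁻ r in J, ‖profile n f x r‖ₑ ∂radial n ∂ν ≤ 4 * (θ * energy n s f +
      θ⁻¹ * (K * ν univ * ∫⁻ r in J, ENNReal.ofReal (r.1 ^ (-(2 * s + β))) ∂radial n)) := by
  have hm := (measurable_profile n hf).enorm
  rw [lintegral_lintegral_swap hm.aemeasurable]
  have hΦ : Measurable fun ξ : Euc (n + 1) => ENNReal.ofReal (‖ξ‖ ^ (2 * s)) * ‖f ξ‖ₑ ^ 2 := by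
    fun_prop
  have hE := lintegral_polar n hΦ
  have hEm := measurable_sphere_lintegral n hΦ
  simp only [norm_polar] at hE hEm
  have hw : Measurable fun r : Ioi (0 : ℝ) => ENNReal.ofReal (r.1 ^ (-(2 * s + β))) :=
    (show Measurable fun r : ℝ => ENNReal.ofReal (r ^ (-(2 * s + β))) by fun_prop).comp
      measurable_subtype_coe
  calc ∫⁻ r in J, ∫⁻ x, ‖profile n f x r‖ₑ ∂ν ∂radial n
      ≤ ∫⁻ r in J, 4 * (θ * ∫⁻ ω, ENNReal.ofReal (r.1 ^ (2 * s)) *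
          ‖f (polar n (ω, r))‖ₑ ^ 2 ∂surf n +
          θ⁻¹ * (K * ν univ * ENNReal.ofReal (r.1 ^ (-(2 * s + β))))) ∂radial n := by
        refine setLIntegral_mono' hJm fun r hr => ?_
        have hr0 : 0 < r.1 := r.2
        have hp : 0 < r.1 ^ (2 * s) := Real.rpow_pos_of_pos hr0 _
        have hp' : ENNReal.ofReal (r.1 ^ (2 * s)) ≠ 0 := by
          simpa only [ne_eq, ENNReal.ofReal_eq_zero, not_le] using hp
        refine (lintegral_enorm_profile_le n hK hf ν hsupp hα r (hJ r hr)
          (θ := θ * ENNReal.ofReal (r.1 ^ (2 * s))) (mul_ne_zero h0 hp')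
          (ENNReal.mul_ne_top ht ENNReal.ofReal_ne_top)).trans (le_of_eq ?_)
        have e1 : ENNReal.ofReal (r.1 ^ (-(2 * s + β))) =
            ENNReal.ofReal (r.1 ^ (-(2 * s))) * ENNReal.ofReal (r.1 ^ (-β)) := by
          rw [← ENNReal.ofReal_mul (Real.rpow_nonneg hr0.le _), ← Real.rpow_add hr0]
          ring_nf
        rw [lintegral_const_mul _ ((measurable_comp_polar n hf r).enorm.pow_const 2),
          ENNReal.mul_inv (Or.inl h0) (Or.inl ht), ofReal_rpow_inv hr0, e1]
        ring
    _ = 4 * (θ * ∫⁻ r in J, ∫⁻ ω, ENNReal.ofReal (r.1 ^ (2 * s)) *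
          ‖f (polar n (ω, r))‖ₑ ^ 2 ∂surf n ∂radial n +
          θ⁻¹ * (K * ν univ * ∫⁻ r in J, ENNReal.ofReal (r.1 ^ (-(2 * s + β))) ∂radial n)) := by
        rw [lintegral_const_mul _ (by fun_prop), lintegral_add_left (by fun_prop),
          lintegral_const_mul _ hEm, lintegral_const_mul _ (by fun_prop),
          lintegral_const_mul _ hw]
    _ ≤ _ := by
        gcongr
        rw [energy, hE]
        exact setLIntegral_le_lintegral _ _

theorem enorm_profile_le (n : ℕ) (f : Euc (n + 1) → ℂ) (x : Euc (n + 1)) (r : Ioi (0 : ℝ)) :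
    ‖profile n f x r‖ₑ ≤ ∫⁻ ω, ‖f (polar n (ω, r))‖ₑ ∂surf n := by
  refine (enorm_integral_le_lintegral_enorm _).trans (le_of_eq ?_)
  simp only [enorm_mul, enorm_exp_ofReal_mul_I, mul_one]

theorem lintegral_sphere_le_ball (n : ℕ) {f : Euc (n + 1) → ℂ} (hf : Measurable f) {R : ℝ}
    {J : Set (Ioi (0 : ℝ))} (hJm : MeasurableSet J) (hJ : ∀ r ∈ J, r.1 < R) :
    ∫⁻ r in J, ∫⁻ ω, ‖f (polar n (ω, r))‖ₑ ∂surf n ∂radial n ≤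
      ∫⁻ ξ in ball (0 : Euc (n + 1)) R, ‖f ξ‖ₑ := by
  have hm : Measurable ((ball (0 : Euc (n + 1)) R).indicator fun ξ => ‖f ξ‖ₑ) :=
    hf.enorm.indicator measurableSet_ball
  rw [← lintegral_indicator measurableSet_ball, lintegral_polar n hm,
    ← lintegral_indicator hJm]
  refine lintegral_mono fun r => ?_
  by_cases hr : r ∈ J
  · rw [indicator_of_mem hr]
    refine lintegral_mono fun ω => ?_
    rw [indicator_of_mem]
    rw [mem_ball_zero_iff, norm_polar]; exact hJ r hr
  · rw [indicator_of_notMem hr]; exact zero_le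

theorem enorm_profile_le_add (n : ℕ) {f : Euc (n + 1) → ℂ} (hf : Measurable f)
    (x y : Euc (n + 1)) (r : Ioi (0 : ℝ)) :
    ‖profile n f x r‖ₑ ≤ ‖profile n f y r‖ₑ +
      ENNReal.ofReal (r.1 * ‖x - y‖) * ∫⁻ ω, ‖f (polar n (ω, r))‖ₑ ∂surf n := by
  have hfr := measurable_comp_polar n hf r
  have hexp : ∀ x, Continuous fun ω : USphere n =>
      Complex.exp ((⟪x, polar n (ω, r)⟫_ℝ : ℝ) * Complex.I) := by
    intro x
    have := continuous_polar n
    fun_prop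
  by_cases hI : Integrable (fun ω : USphere n => f (polar n (ω, r))) (surf n)
  · have hI' : ∀ x, Integrable (fun ω : USphere n => f (polar n (ω, r)) *
        Complex.exp ((⟪x, polar n (ω, r)⟫_ℝ : ℝ) * Complex.I)) (surf n) := fun x =>
      hI.mul_bdd (c := 1) (hexp x).aestronglyMeasurable
        (ae_of_all _ fun ω => (Complex.norm_exp_ofReal_mul_I _).le)
    have h1 : ‖profile n f x r - profile n f y r‖ₑ ≤
        ENNReal.ofReal (r.1 * ‖x - y‖) * ∫⁻ ω, ‖f (polar n (ω, r))‖ₑ ∂surf n := by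
      unfold profile
      rw [← integral_sub (hI' x) (hI' y), ← lintegral_const_mul _ hfr.enorm]
      refine (enorm_integral_le_lintegral_enorm _).trans (lintegral_mono fun ω => ?_)
      rw [← mul_sub, enorm_mul, mul_comm]
      gcongr
      rw [← ofReal_norm]
      refine ENNReal.ofReal_le_ofReal ?_
      set a := ⟪x, polar n (ω, r)⟫_ℝ
      set b := ⟪y, polar n (ω, r)⟫_ℝ
      have hab : |a - b| ≤ r.1 * ‖x - y‖ := by
        have : a - b = ⟪x - y, polar n (ω, r)⟫_ℝ := (inner_sub_left _ _ _).symm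
        rw [this]
        refine (abs_real_inner_le_norm _ _).trans (le_of_eq ?_)
        rw [norm_polar, mul_comm]
      refine le_trans ?_ hab
      have e : Complex.exp (a * Complex.I) - Complex.exp (b * Complex.I) =
          Complex.exp (b * Complex.I) * (Complex.exp (Complex.I * ((a - b : ℝ) : ℂ)) - 1) := by
        rw [mul_sub, ← Complex.exp_add, mul_one]
        congr 2
        push_cast; ring
      rw [e, norm_mul, Complex.norm_exp_ofReal_mul_I, one_mul]
      exact Real.norm_exp_I_mul_ofReal_sub_one_le
    calc ‖profile n f x r‖ₑ = ‖profile n f y r + (profile n f x r - profile n f y r)‖ₑ := by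
          rw [add_sub_cancel]
      _ ≤ ‖profile n f y r‖ₑ + ‖profile n f x r - profile n f y r‖ₑ := enorm_add_le _ _
      _ ≤ _ := by gcongr
  · have : profile n f x r = 0 := by
      refine integral_undef fun h => hI ?_
      refine h.mono hfr.aestronglyMeasurable (ae_of_all _ fun ω => ?_)
      rw [norm_mul, Complex.norm_exp_ofReal_mul_I, mul_one]
    rw [this, enorm_zero]; exact zero_le

theorem block_le_add (n : ℕ) {f : Euc (n + 1) → ℂ} (hf : Measurable f) {R : ℝ}
    {J : Set (Ioi (0 : ℝ))} (hJm : MeasurableSet J) (hJ : ∀ r ∈ J, r.1 < R) (x y : Euc (n + 1)) :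
    ∫⁻ r in J, ‖profile n f x r‖ₑ ∂radial n ≤ ∫⁻ r in J, ‖profile n f y r‖ₑ ∂radial n +
      ENNReal.ofReal (R * ‖x - y‖) * ∫⁻ ξ in ball (0 : Euc (n + 1)) R, ‖f ξ‖ₑ := by
  have hy : Measurable fun r : Ioi (0 : ℝ) => ‖profile n f y r‖ₑ :=
    ((measurable_profile n hf).comp measurable_prodMk_left).enorm
  calc _ ≤ ∫⁻ r in J, (‖profile n f y r‖ₑ +
        ENNReal.ofReal (R * ‖x - y‖) * ∫⁻ ω, ‖f (polar n (ω, r))‖ₑ ∂surf n) ∂radial n := by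
        refine setLIntegral_mono' hJm fun r hr => ?_
        refine (enorm_profile_le_add n hf x y r).trans ?_
        gcongr
        exact (hJ r hr).le
    _ = ∫⁻ r in J, ‖profile n f y r‖ₑ ∂radial n + ENNReal.ofReal (R * ‖x - y‖) *
        ∫⁻ r in J, ∫⁻ ω, ‖f (polar n (ω, r))‖ₑ ∂surf n ∂radial n := by
        rw [lintegral_add_left hy, lintegral_const_mul _ (measurable_sphere_lintegral n hf.enorm)]
    _ ≤ _ := by gcongr; exact lintegral_sphere_le_ball n hf hJm hJ

/-- The constants `C₁`, `C₂` are admissible in Frostman's lemma. -/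
def FrostmanConstants (d : ℕ) (α : ℝ) (hα : 0 < α) (C₁ C₂ : ℝ≥0) : Prop :=
  ∀ S ⊆ closedBall (0 : Euc d) (1 / 2), ∀ δ : ℝ, 0 < δ →
    ∃ ν : Measure (Euc d), IsFiniteMeasure ν ∧ ν (thickening δ S)ᶜ = 0 ∧
      ν (closedBall 0 1)ᶜ = 0 ∧ cAlpha d α ν ≤ C₁ ∧
      hausdorffContent α hα S ≤ C₂ * ν univ

theorem hausdorffContent_block_le (n : ℕ) {s α β : ℝ} (hα : 0 < α) {C₁ C₂ K : ℝ≥0}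
    (hF : FrostmanConstants (n + 1) α hα C₁ C₂) (hK : SphericalDecay n α β C₁ K)
    {f : Euc (n + 1) → ℂ} (hf : Measurable f) {E : ℝ≥0} (hE : energy n s f = E) {R : ℝ}
    (hR0 : 0 ≤ R) (hR : ∫⁻ ξ in ball (0 : Euc (n + 1)) R, ‖f ξ‖ₑ < ⊤)
    {J : Set (Ioi (0 : ℝ))} (hJm : MeasurableSet J) (hJ : ∀ r ∈ J, 1 < r.1)
    (hJR : ∀ r ∈ J, r.1 < R) {b l : ℝ≥0} (hb : 0 < b) (hl : 0 < l)
    (hJb : (K : ℝ≥0∞) * ∫⁻ r in J, ENNReal.ofReal (r.1 ^ (-(2 * s + β))) ∂radial n ≤ b) :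
    hausdorffContent α hα ({x | (l : ℝ≥0∞) < ∫⁻ r in J, ‖profile n f x r‖ₑ ∂radial n} ∩
      closedBall 0 (1 / 2)) ≤ (C₂ * (256 * b * E / l ^ 2) : ℝ≥0) := by
  set G : Euc (n + 1) → ℝ≥0∞ := fun x => ∫⁻ r in J, ‖profile n f x r‖ₑ ∂radial n with hG
  set S := {x | (l : ℝ≥0∞) < G x} ∩ closedBall 0 (1 / 2) with hS
  set L : ℝ≥0 := (∫⁻ ξ in ball (0 : Euc (n + 1)) R, ‖f ξ‖ₑ).toNNReal
  have hL : (L : ℝ≥0∞) = ∫⁻ ξ in ball (0 : Euc (n + 1)) R, ‖f ξ‖ₑ := ENNReal.coe_toNNReal hR.ne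
  set δ : ℝ := (l / 2) / (R * L + 1) with hδ
  have hRL : 0 < R * L + 1 := by positivity
  have hl' : (0 : ℝ) < l := by exact_mod_cast hl
  have hb' : (0 : ℝ) < b := by exact_mod_cast hb
  have hδ0 : 0 < δ := by positivity
  obtain ⟨ν, hνf, hνS, hν1, hνα, hcont⟩ := hF S inter_subset_right δ hδ0
  refine hcont.trans ?_
  have hmt : ν univ ≠ ⊤ := measure_ne_top _ _
  lift ν univ to ℝ≥0 using hmt with m hm
  have hlow : ∀ᵐ x ∂ν, ((l / 2 : ℝ≥0) : ℝ≥0∞) ≤ G x := by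
    filter_upwards [show ∀ᵐ x ∂ν, x ∈ thickening δ S from hνS] with x hx
    obtain ⟨y, hy, hxy⟩ := mem_thickening_iff.1 hx
    have h1 := block_le_add n hf hJm hJR y x
    have h2 : ENNReal.ofReal (R * ‖y - x‖) * ∫⁻ ξ in ball (0 : Euc (n + 1)) R, ‖f ξ‖ₑ ≤
        ((l / 2 : ℝ≥0) : ℝ≥0∞) := by
      rw [← hL, ← ENNReal.ofReal_coe_nnreal (p := L), ← ENNReal.ofReal_mul (by positivity),
        ← ENNReal.ofReal_coe_nnreal (p := l / 2)]
      refine ENNReal.ofReal_le_ofReal ?_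
      rw [dist_comm, dist_eq_norm] at hxy
      calc R * ‖y - x‖ * L ≤ R * δ * L := by gcongr
        _ ≤ δ * (R * L + 1) := by nlinarith
        _ = l / 2 := by rw [hδ]; field_simp
        _ = _ := by push_cast; rfl
    have h3 : (l : ℝ≥0∞) ≤ G x + ((l / 2 : ℝ≥0) : ℝ≥0∞) :=
      (hy.1.le.trans h1).trans (by gcongr)
    have h4 : (l : ℝ≥0∞) = ((l / 2 : ℝ≥0) : ℝ≥0∞) + ((l / 2 : ℝ≥0) : ℝ≥0∞) := by
      rw [← ENNReal.coe_add, add_halves]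
    rw [h4] at h3
    exact ENNReal.le_of_add_le_add_right ENNReal.coe_ne_top h3
  set θ : ℝ≥0 := 16 * b / l with hθ
  have hθ0 : θ ≠ 0 := by positivity
  have hup := lintegral_block_le n (s := s) hK hf ν hν1 hνα hJm hJ (θ := θ)
    (by exact_mod_cast hθ0) ENNReal.coe_ne_top
  have hlow2 : ((l / 2 : ℝ≥0) : ℝ≥0∞) * m ≤ ∫⁻ x, G x ∂ν := by
    rw [hm, ← lintegral_const]; exact lintegral_mono_ae hlow
  have hmain : ((l / 2 : ℝ≥0) : ℝ≥0∞) * m ≤ 4 * (θ * E + (θ⁻¹ : ℝ≥0) * (m * b)) := by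
    refine hlow2.trans (hup.trans ?_)
    rw [hE, ENNReal.coe_inv hθ0, ← hm, mul_comm (K : ℝ≥0∞), mul_assoc]
    gcongr
  have hmain' : (l / 2) * m ≤ 4 * (θ * E + θ⁻¹ * (m * b)) := by exact_mod_cast hmain
  rw [← ENNReal.coe_mul]
  refine ENNReal.coe_le_coe.2 ?_
  gcongr
  rw [← NNReal.coe_le_coe] at hmain' ⊢
  rw [hθ] at hmain'
  push_cast at hmain' ⊢
  rw [le_div_iff₀ (by positivity)]
  have e : 4 * (16 * (b : ℝ) / l * E + (16 * (b : ℝ) / l)⁻¹ * (m * b)) =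
      64 * b * E / l + l * m / 4 := by field_simp; ring
  rw [e] at hmain'
  have h5 : (l : ℝ) * m / 4 ≤ 64 * b * E / l := by linarith
  rw [le_div_iff₀ hl'] at h5
  nlinarith

theorem exists_radius (n : ℕ) {γ : ℝ} (hγ : (n : ℝ) + 1 < γ) (K : ℝ≥0) (k : ℕ) {b : ℝ≥0}
    (hb : 0 < b) : ∃ R : ℝ, 1 < R ∧ k ≤ R ∧
      (K : ℝ≥0∞) * ∫⁻ r in {r : Ioi (0 : ℝ) | R ≤ r.1}, ENNReal.ofReal (r.1 ^ (-γ)) ∂radial n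
        ≤ b := by
  set μ := (radial n).withDensity fun r : Ioi (0 : ℝ) => ENNReal.ofReal (r.1 ^ (-γ))
  set A : ℕ → Set (Ioi (0 : ℝ)) := fun N => {r | (N : ℝ) + 2 ≤ r.1}
  have hAm : ∀ N, MeasurableSet (A N) := fun N =>
    measurableSet_le measurable_const measurable_subtype_coe
  have hanti : Antitone A := by
    intro N M hNM r hr
    have : (N : ℝ) ≤ M := by exact_mod_cast hNM
    simp only [A, mem_ofPred_eq] at hr ⊢
    linarith
  have hfin : μ (A 0) ≠ ⊤ := by
    rw [withDensity_apply _ (hAm 0)]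
    refine ((lintegral_mono_set ?_).trans_lt (lintegral_radial_rpow_lt_top n hγ one_pos)).ne
    intro r hr
    simp only [A, mem_ofPred_eq] at hr ⊢
    push_cast at hr; linarith
  have hempty : ⋂ N, A N = ∅ := by
    refine eq_empty_of_forall_notMem fun r hr => ?_
    obtain ⟨N, hN⟩ := exists_nat_gt r.1
    have := mem_iInter.1 hr N
    simp only [A, mem_ofPred_eq] at this
    linarith
  have htend := tendsto_measure_iInter_atTop (μ := μ) (fun N => (hAm N).nullMeasurableSet)
    hanti ⟨0, hfin⟩
  rw [hempty, measure_empty] at htend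
  have htend2 := ENNReal.Tendsto.const_mul (a := (K : ℝ≥0∞)) htend (Or.inr ENNReal.coe_ne_top)
  rw [mul_zero] at htend2
  have hev := htend2.eventually (ge_mem_nhds (show (0 : ℝ≥0∞) < b by exact_mod_cast hb))
  obtain ⟨N, hN1, hN2⟩ := (hev.and (eventually_ge_atTop k)).exists
  have : (k : ℝ) ≤ N := by exact_mod_cast hN2
  refine ⟨N + 2, by linarith [N.cast_nonneg (α := ℝ)], by linarith, ?_⟩
  rwa [Function.comp_apply, withDensity_apply _ (hAm N)] at hN1

/-- The points at which the Fourier integral of `f` fails to converge absolutely in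
the radial variable, after integration over spheres. -/
def radialDivergenceSet (n : ℕ) (f : Euc (n + 1) → ℂ) : Set (Euc (n + 1)) :=
  {x | ∫⁻ r, ‖profile n f x r‖ₑ ∂radial n = ⊤}

theorem hausdorffContent_radialDivergenceSet (n : ℕ) {s α β : ℝ} (hs : 0 < s)
    (hsn : 2 * s < n + 1) (hβ : (n : ℝ) + 1 - 2 * s < β) (hα : 0 < α) {C₁ C₂ K : ℝ≥0}
    (hF : FrostmanConstants (n + 1) α hα C₁ C₂) (hK : SphericalDecay n α β C₁ K)
    {f : Euc (n + 1) → ℂ} (hf : Measurable f) (hE : energy n s f ≠ ⊤) :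
    hausdorffContent α hα (radialDivergenceSet n f ∩ closedBall 0 (1 / 2)) = 0 := by
  have hball := lintegral_ball_lt_top n hs hsn hf hE
  obtain ⟨E, hE'⟩ : ∃ E : ℝ≥0, (E : ℝ≥0∞) = energy n s f := ⟨_, ENNReal.coe_toNNReal hE⟩
  choose R hR1 hRk hRtail using fun k : ℕ =>
    exists_radius n (γ := 2 * s + β) (by linarith) K k (b := (1 / 8) ^ k) (by positivity)
  set J : ℕ → Set (Ioi (0 : ℝ)) := fun k => {r | R k ≤ r.1 ∧ r.1 < R (k + 1)} with hJ
  have hJm : ∀ k, MeasurableSet (J k) := fun k =>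
    (measurableSet_le measurable_const measurable_subtype_coe).inter
      (measurableSet_lt measurable_subtype_coe measurable_const)
  set I : Set (Ioi (0 : ℝ)) := {r | r.1 < R 0} with hI
  have hIm : MeasurableSet I := measurableSet_lt measurable_subtype_coe measurable_const
  have hcover : univ ⊆ I ∪ ⋃ k, J k := by
    intro r _
    by_cases h0 : r ∈ I
    · exact Or.inl h0
    refine Or.inr ?_
    have hex : ∃ k, r.1 < R k := by
      obtain ⟨k, hk⟩ := exists_nat_gt r.1
      exact ⟨k, hk.trans_le (hRk k)⟩
    classical
    have h1 := Nat.find_spec hex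
    rcases hfind : Nat.find hex with _ | k
    · rw [hfind] at h1; exact absurd h1 h0
    · rw [hfind] at h1
      have h2 : ¬ r.1 < R k := Nat.find_min hex (by omega)
      exact mem_iUnion.2 ⟨k, not_lt.1 h2, h1⟩
  set G : ℕ → Euc (n + 1) → ℝ≥0∞ := fun k x => ∫⁻ r in J k, ‖profile n f x r‖ₑ ∂radial n with hG
  have hfinite : ∀ (A : Set (Ioi (0 : ℝ))) (ρ : ℝ) (x : Euc (n + 1)), MeasurableSet A →
      (∀ r ∈ A, r.1 < ρ) → ∫⁻ r in A, ‖profile n f x r‖ₑ ∂radial n < ⊤ := by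
    intro A ρ x hA hAρ
    exact ((lintegral_mono fun r => enorm_profile_le n f x r).trans
      (lintegral_sphere_le_ball n hf hA hAρ)).trans_lt (hball ρ)
  set S : ℕ → Set (Euc (n + 1)) := fun k =>
    {x | (((1 / 2) ^ k : ℝ≥0) : ℝ≥0∞) < G k x} ∩ closedBall 0 (1 / 2) with hS
  have hSle : ∀ k, hausdorffContent α hα (S k) ≤
      ((C₂ * 256 * E * (1 / 2) ^ k : ℝ≥0) : ℝ≥0∞) := by
    intro k
    refine (hausdorffContent_block_le n hα hF hK hf hE'.symm (R := R (k + 1))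
      (zero_le_one.trans (hR1 _).le) (hball _)
      (hJm k) (fun r hr => (hR1 k).trans_le hr.1) (fun r hr => hr.2) (b := (1 / 8) ^ k)
      (l := (1 / 2) ^ k) (by positivity) (by positivity) ?_).trans (le_of_eq ?_)
    · refine le_trans ?_ (hRtail k)
      gcongr
      exact fun r hr => hr.1
    · congr 1
      have : ((1 : ℝ≥0) / 8) ^ k = (1 / 2) ^ k * ((1 / 2) ^ k) ^ 2 := by
        rw [← pow_mul, mul_comm k 2, pow_mul, ← mul_pow]; norm_num
      rw [this]
      have h2 : ((1 : ℝ≥0) / 2) ^ k ≠ 0 := by positivity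
      field_simp
  have hsum : ∑' k, hausdorffContent α hα (S k) ≠ ⊤ := by
    refine ne_top_of_le_ne_top ?_ (ENNReal.tsum_le_tsum hSle)
    rw [ENNReal.tsum_coe_ne_top_iff_summable]
    exact (NNReal.summable_geometric (by norm_num)).mul_left _
  refine measure_mono_null ?_ (measure_limsup_atTop_eq_zero hsum)
  rintro x ⟨hx, hxb⟩
  rw [limsup_eq_iInf_iSup_of_nat]
  simp only [iSup_eq_iUnion, iInf_eq_iInter, mem_iInter, mem_iUnion]
  by_contra! hcon
  obtain ⟨m, hm⟩ := hcon
  have hGle : ∀ k, m ≤ k → G k x ≤ (((1 / 2) ^ k : ℝ≥0) : ℝ≥0∞) := by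
    intro k hk
    by_contra! h
    exact hm k hk ⟨h, hxb⟩
  have htot : ∫⁻ r, ‖profile n f x r‖ₑ ∂radial n ≤
      ∫⁻ r in I, ‖profile n f x r‖ₑ ∂radial n + ∑' k, G k x := by
    rw [← setLIntegral_univ]
    refine (lintegral_mono_set hcover).trans ((lintegral_union_le _ _ _).trans ?_)
    gcongr
    exact lintegral_iUnion_le _ _
  have hGsum : ∑' k, G k x < ⊤ := by
    have hsplit : ∑ k ∈ Finset.range m, G k x + ∑' k, G (k + m) x = ∑' k, G k x :=
      ENNReal.summable.sum_add_tsum_nat_add' (f := fun k => G k x)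
    rw [← hsplit]
    refine ENNReal.add_lt_top.2 ⟨?_, ?_⟩
    · exact ENNReal.sum_lt_top.2 fun k _ => hfinite _ _ x (hJm k) fun r hr => hr.2
    · refine (ENNReal.tsum_le_tsum fun k => hGle (k + m) (Nat.le_add_left m k)).trans_lt ?_
      rw [lt_top_iff_ne_top, ENNReal.tsum_coe_ne_top_iff_summable]
      exact (NNReal.summable_nat_add_iff m).2 (NNReal.summable_geometric (by norm_num))
  refine (htot.trans_lt (ENNReal.add_lt_top.2 ⟨?_, hGsum⟩)).ne hx
  exact hfinite _ _ x hIm fun r hr => hr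

theorem profile_modulate (n : ℕ) (f : Euc (n + 1) → ℂ) (x₀ x : Euc (n + 1)) (r : Ioi (0 : ℝ)) :
    profile n (fun ξ => f ξ * Complex.exp ((⟪x₀, ξ⟫_ℝ : ℝ) * Complex.I)) x r =
      profile n f (x + x₀) r := by
  unfold profile
  congr 1; ext ω
  rw [mul_assoc, ← Complex.exp_add, inner_add_left]
  congr 2
  push_cast; ring

theorem dimH_radialDivergenceSet_le (n : ℕ) (hn : 0 < n) {s α β C₀ : ℝ} (hs : 0 < s)
    (hsn : 2 * s < n + 1) (hβ : (n : ℝ) + 1 - 2 * s < β) (hα : 0 < α) (hαn : α ≤ (n + 1 : ℕ))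
    (hdecay : ∀ ν : Measure (Euc (n + 1)), IsAlphaDimensional (n + 1) α ν →
      ∀ R : ℝ, 1 < R →
        ∫ ω, ‖fourierMeasure ν (R • ω)‖ ^ 2 ∂(sphereMeasure (n + 1))
          ≤ C₀ * (cAlpha (n + 1) α ν).toReal * (ν univ).toReal * R ^ (-β))
    {f : Euc (n + 1) → ℂ} (hf : Measurable f) (hE : energy n s f ≠ ⊤) :
    dimH (radialDivergenceSet n f) ≤ ENNReal.ofReal α := by
  obtain ⟨C₁, C₂, hF⟩ := exists_frostman_measure (n + 1) hα hαn
  obtain ⟨K, hK⟩ := exists_sphericalDecay hn hdecay C₁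
  have hlocal : ∀ x₀ : Euc (n + 1),
      dimH (radialDivergenceSet n f ∩ closedBall x₀ (1 / 2)) ≤ ENNReal.ofReal α := by
    intro x₀
    set g : Euc (n + 1) → ℂ := fun ξ => f ξ * Complex.exp ((⟪x₀, ξ⟫_ℝ : ℝ) * Complex.I) with hg
    have hgm : Measurable g := hf.mul (by fun_prop)
    have hgE : energy n s g = energy n s f := by
      simp only [energy, hg, enorm_mul, enorm_exp_ofReal_mul_I, mul_one]
    have h0 := hausdorffMeasure_eq_zero_of_content hα
      (hausdorffContent_radialDivergenceSet n hs hsn hβ hα hF hK hgm (hgE ▸ hE))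
    have h1 : dimH (radialDivergenceSet n g ∩ closedBall 0 (1 / 2)) ≤ ENNReal.ofReal α := by
      refine dimH_le_of_hausdorffMeasure_ne_top ?_
      rw [Real.coe_toNNReal _ hα.le, h0]; simp
    have himg : radialDivergenceSet n f ∩ closedBall x₀ (1 / 2) =
        IsometryEquiv.addRight x₀ '' (radialDivergenceSet n g ∩ closedBall 0 (1 / 2)) := by
      ext y
      rw [← IsometryEquiv.preimage_symm]
      simp [radialDivergenceSet, hg, profile_modulate, dist_eq_norm, sub_eq_add_neg]
    rw [himg, IsometryEquiv.dimH_image]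
    exact h1
  have hcov : radialDivergenceSet n f ⊆
      ⋃ k : ℕ, radialDivergenceSet n f ∩ closedBall (TopologicalSpace.denseSeq _ k) (1 / 2) := by
    intro x hx
    obtain ⟨y, hk, ⟨k, rfl⟩⟩ := Metric.dense_iff.1
      (TopologicalSpace.denseRange_denseSeq (Euc (n + 1))) x (1 / 2) (by norm_num)
    refine mem_iUnion.2 ⟨k, hx, ?_⟩
    rw [mem_closedBall, dist_comm]
    exact (mem_ball.1 hk).le
  refine (dimH_mono hcov).trans ?_
  rw [dimH_iUnion]
  exact iSup_le fun k => hlocal _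

/-- The half-wave evolution of `f` at the point `x` and time `t`. -/
noncomputable def halfWave (n : ℕ) (f : Euc (n + 1) → ℂ) (x : Euc (n + 1)) (t : ℝ) : ℂ :=
  ∫ r : Ioi (0 : ℝ), Complex.exp ((t * r.1 : ℝ) * Complex.I) * profile n f x r ∂radial n

/-- The frequency-truncated half-wave evolution of `f`. -/
noncomputable def halfWavePartial (n : ℕ) (ψ : SchwartzMap ℝ ℝ) (f : Euc (n + 1) → ℂ)
    (x : Euc (n + 1)) (t N : ℝ) : ℂ :=
  ∫ ξ, ((ψ (‖ξ‖ / N) : ℝ) : ℂ) * (f ξ *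
    Complex.exp (Complex.I * (((⟪x, ξ⟫_ℝ : ℝ) : ℂ) + (t : ℂ) * ((‖ξ‖ : ℝ) : ℂ))))

theorem integrable_halfWavePartial (n : ℕ) {s : ℝ} (hs : 0 < s) (hsn : 2 * s < n + 1)
    (ψ : SchwartzMap ℝ ℝ) {f : Euc (n + 1) → ℂ} (hf : Measurable f) (hE : energy n s f ≠ ⊤)
    (x : Euc (n + 1)) (t : ℝ) {N : ℝ} (hN : 0 < N) :
    Integrable fun ξ => ((ψ (‖ξ‖ / N) : ℝ) : ℂ) * (f ξ *
      Complex.exp (Complex.I * (((⟪x, ξ⟫_ℝ : ℝ) : ℂ) + (t : ℂ) * ((‖ξ‖ : ℝ) : ℂ)))) := by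
  have hψ := ψ.continuous
  obtain ⟨B₀, hB₀⟩ := ψ.decay 0 0
  obtain ⟨B₁, hB₁⟩ := ψ.decay (n + 1) 0
  have h := lintegral_weight_mul_lt_top n hs hsn (g := fun r => ψ (r / N)) (by fun_prop)
    (C := max B₀ (N ^ (n + 1) * B₁)) ?_ ?_ hf hE
  · refine ⟨Measurable.aestronglyMeasurable (by fun_prop), lt_of_le_of_lt (le_of_eq ?_) h⟩
    congr 1; ext ξ
    have e : Complex.I * (((⟪x, ξ⟫_ℝ : ℝ) : ℂ) + (t : ℂ) * ((‖ξ‖ : ℝ) : ℂ)) =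
        ((⟪x, ξ⟫_ℝ + t * ‖ξ‖ : ℝ) : ℂ) * Complex.I := by push_cast; ring
    beta_reduce
    rw [e, enorm_mul, enorm_mul, enorm_exp_ofReal_mul_I, mul_one]
    congr 1
    rw [← ofReal_norm, ← ofReal_norm, Complex.norm_real]
  · intro r _
    refine le_trans ?_ (le_max_left _ _)
    simpa using hB₀.2 (r / N)
  · intro r hr
    refine le_trans ?_ (le_max_right _ _)
    have h1 := hB₁.2 (r / N)
    rw [norm_iteratedFDeriv_zero, Real.norm_eq_abs, Real.norm_eq_abs,
      abs_of_pos (div_pos hr hN), div_pow] at h1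
    calc |ψ (r / N)| * r ^ (n + 1) = N ^ (n + 1) * (r ^ (n + 1) / N ^ (n + 1) * |ψ (r / N)|) := by
          field_simp
      _ ≤ _ := by gcongr

theorem halfWavePartial_eq (n : ℕ) {s : ℝ} (hs : 0 < s) (hsn : 2 * s < n + 1)
    (ψ : SchwartzMap ℝ ℝ) {f : Euc (n + 1) → ℂ} (hf : Measurable f) (hE : energy n s f ≠ ⊤)
    (x : Euc (n + 1)) (t : ℝ) {N : ℝ} (hN : 0 < N) :
    halfWavePartial n ψ f x t N = ∫ r : Ioi (0 : ℝ), ((ψ (r.1 / N) : ℝ) : ℂ) *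
      (Complex.exp ((t * r.1 : ℝ) * Complex.I) * profile n f x r) ∂radial n := by
  rw [halfWavePartial, integral_polar n (integrable_halfWavePartial n hs hsn ψ hf hE x t hN)]
  congr 1; ext r
  simp only [norm_polar]
  rw [profile, ← integral_const_mul, ← integral_const_mul]
  congr 1; ext ω
  have e : Complex.I * (((⟪x, polar n (ω, r)⟫_ℝ : ℝ) : ℂ) + (t : ℂ) * ((r.1 : ℝ) : ℂ)) =
    ((t * r.1 : ℝ) : ℂ) * Complex.I + ((⟪x, polar n (ω, r)⟫_ℝ : ℝ) : ℂ) * Complex.I := by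
      push_cast; ring
  rw [e, Complex.exp_add]
  ring

theorem integrable_profile (n : ℕ) {f : Euc (n + 1) → ℂ} (hf : Measurable f) {x : Euc (n + 1)}
    (hx : x ∉ radialDivergenceSet n f) : Integrable (profile n f x) (radial n) :=
  ⟨((measurable_profile n hf).comp measurable_prodMk_left).aestronglyMeasurable,
    lt_top_iff_ne_top.2 hx⟩

theorem tendsto_halfWavePartial (n : ℕ) {s : ℝ} (hs : 0 < s) (hsn : 2 * s < n + 1)
    (ψ : SchwartzMap ℝ ℝ) {f : Euc (n + 1) → ℂ} (hf : Measurable f) (hE : energy n s f ≠ ⊤)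
    {x : Euc (n + 1)} (hx : x ∉ radialDivergenceSet n f) (t : ℝ) :
    Tendsto (fun N => halfWavePartial n ψ f x t N) atTop (𝓝 ((ψ 0 : ℝ) * halfWave n f x t)) := by
  have hψ := ψ.continuous
  have hpm : Measurable (profile n f x) := (measurable_profile n hf).comp measurable_prodMk_left
  obtain ⟨B, hB⟩ := ψ.decay 0 0
  rw [halfWave, ← integral_const_mul]
  have hev : (fun N => ∫ r : Ioi (0 : ℝ), ((ψ (r.1 / N) : ℝ) : ℂ) *
      (Complex.exp ((t * r.1 : ℝ) * Complex.I) * profile n f x r) ∂radial n) =ᶠ[atTop]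
      fun N => halfWavePartial n ψ f x t N := by
    filter_upwards [eventually_gt_atTop 0] with N hN
    exact (halfWavePartial_eq n hs hsn ψ hf hE x t hN).symm
  refine Tendsto.congr' hev ?_
  refine tendsto_integral_filter_of_dominated_convergence (fun r => B * ‖profile n f x r‖)
    (Eventually.of_forall fun N => ?_) (Eventually.of_forall fun N => ae_of_all _ fun r => ?_)
    ((integrable_profile n hf hx).norm.const_mul B) (ae_of_all _ fun r => ?_)
  · exact Measurable.aestronglyMeasurable (by fun_prop)
  · rw [norm_mul, norm_mul, Complex.norm_exp_ofReal_mul_I, one_mul, Complex.norm_real]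
    gcongr
    simpa using hB.2 (r.1 / N)
  · refine Tendsto.mul_const _ ?_
    have h1 : Tendsto (fun N : ℝ => r.1 / N) atTop (𝓝 0) := tendsto_const_nhds.div_atTop tendsto_id
    exact (Complex.continuous_ofReal.tendsto _).comp ((hψ.tendsto 0).comp h1)

theorem continuous_halfWave (n : ℕ) {f : Euc (n + 1) → ℂ} (hf : Measurable f)
    {x : Euc (n + 1)} (hx : x ∉ radialDivergenceSet n f) : Continuous (halfWave n f x) := by
  have hpm : Measurable (profile n f x) := (measurable_profile n hf).comp measurable_prodMk_left
  refine continuous_of_dominated (bound := fun r => ‖profile n f x r‖) (fun t => ?_)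
    (fun t => ae_of_all _ fun r => ?_) (integrable_profile n hf hx).norm
    (ae_of_all _ fun r => ?_)
  · exact Measurable.aestronglyMeasurable (by fun_prop)
  · rw [norm_mul, Complex.norm_exp_ofReal_mul_I, one_mul]
  · fun_prop

theorem wavePartial_eq_halfWavePartial (n : ℕ) {s : ℝ} (hs : 0 < s) (hsn : 2 * s < n + 1)
    (ψ : SchwartzMap ℝ ℝ) {F₀ F₁ f g : Euc (n + 1) → ℂ}
    (hfdef : f = fun ξ => (1 / 2 : ℂ) * (F₀ ξ - Complex.I * ((‖ξ‖⁻¹ : ℝ) : ℂ) * F₁ ξ))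
    (hgdef : g = fun ξ => (1 / 2 : ℂ) * (F₀ ξ + Complex.I * ((‖ξ‖⁻¹ : ℝ) : ℂ) * F₁ ξ))
    (hf : Measurable f) (hg : Measurable g) (hfE : energy n s f ≠ ⊤) (hgE : energy n s g ≠ ⊤)
    (x : Euc (n + 1)) (t : ℝ) {N : ℝ} (hN : 0 < N) :
    wavePartial (n + 1) ψ F₀ F₁ x t N =
      halfWavePartial n ψ f x t N + halfWavePartial n ψ g x (-t) N := by
  rw [halfWavePartial, halfWavePartial, wavePartial,
    ← integral_add (integrable_halfWavePartial n hs hsn ψ hf hfE x t hN)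
      (integrable_halfWavePartial n hs hsn ψ hg hgE x (-t) hN)]
  congr 1; ext ξ
  rw [hfdef, hgdef, ← mul_add]
  push_cast
  rw [neg_mul, ← sub_eq_add_neg]

theorem waveDivergenceSet_subset (n : ℕ) {s : ℝ} (hs : 0 < s) (hsn : 2 * s < n + 1)
    (ψ : SchwartzMap ℝ ℝ) {F₀ F₁ f g : Euc (n + 1) → ℂ}
    (hfdef : f = fun ξ => (1 / 2 : ℂ) * (F₀ ξ - Complex.I * ((‖ξ‖⁻¹ : ℝ) : ℂ) * F₁ ξ))
    (hgdef : g = fun ξ => (1 / 2 : ℂ) * (F₀ ξ + Complex.I * ((‖ξ‖⁻¹ : ℝ) : ℂ) * F₁ ξ))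
    (hf : Measurable f) (hg : Measurable g) (hfE : energy n s f ≠ ⊤) (hgE : energy n s g ≠ ⊤) :
    waveDivergenceSet (n + 1) ψ F₀ F₁ ⊆ radialDivergenceSet n f ∪ radialDivergenceSet n g := by
  intro x hx
  by_contra hcon
  rw [mem_union, not_or] at hcon
  obtain ⟨hxf, hxg⟩ := hcon
  set W : ℝ → ℂ := fun t => (ψ 0 : ℝ) * halfWave n f x t + (ψ 0 : ℝ) * halfWave n g x (-t) with hW
  have hlim : ∀ t, Tendsto (fun N => wavePartial (n + 1) ψ F₀ F₁ x t N) atTop (𝓝 (W t)) := by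
    intro t
    refine Tendsto.congr' ?_ ((tendsto_halfWavePartial n hs hsn ψ hf hfE hxf t).add
      (tendsto_halfWavePartial n hs hsn ψ hg hgE hxg (-t)))
    filter_upwards [eventually_gt_atTop 0] with N hN
    exact (wavePartial_eq_halfWavePartial n hs hsn ψ hfdef hgdef hf hg hfE hgE x t hN).symm
  have hsol : waveSol (n + 1) ψ F₀ F₁ x = W := funext fun t => (hlim t).limUnder_eq
  have hcont : Continuous W := by
    have h1 := continuous_halfWave n hf hxf
    have h2 := continuous_halfWave n hg hxg
    fun_prop
  refine hx ⟨⟨_, hlim 0⟩, 1, one_pos, fun t _ _ => ⟨_, hlim t⟩, ?_⟩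
  rw [hsol]
  exact (hcont.tendsto 0).mono_left nhdsWithin_le_nhds

theorem energy_ne_top (n : ℕ) {s : ℝ} {F₀ F₁ f : Euc (n + 1) → ℂ}
    (hF₀ : Integrable (fun ξ => ‖ξ‖ ^ (2 * s) * ‖F₀ ξ‖ ^ 2) volume)
    (hF₁ : Integrable (fun ξ => ‖ξ‖ ^ (2 * (s - 1)) * ‖F₁ ξ‖ ^ 2) volume)
    (hf : ∀ ξ, ‖f ξ‖ ≤ 1 / 2 * (‖F₀ ξ‖ + ‖ξ‖⁻¹ * ‖F₁ ξ‖)) : energy n s f ≠ ⊤ := by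
  refine (lt_of_le_of_lt ?_ (hF₀.add hF₁).lintegral_lt_top).ne
  refine lintegral_mono_ae ?_
  have h0 : ∀ᵐ ξ : Euc (n + 1), ξ ≠ 0 := by simp [ae_iff]
  filter_upwards [h0] with ξ hξ
  have hξ' : 0 < ‖ξ‖ := norm_pos_iff.2 hξ
  rw [← ofReal_norm, ← ENNReal.ofReal_pow (norm_nonneg _), ← ENNReal.ofReal_mul (by positivity)]
  refine ENNReal.ofReal_le_ofReal ?_
  have e : ‖ξ‖ ^ (2 * (s - 1)) = ‖ξ‖ ^ (2 * s) * ‖ξ‖⁻¹ ^ 2 := by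
    rw [inv_pow, ← Real.rpow_natCast, ← Real.rpow_neg hξ'.le, ← Real.rpow_add hξ']
    congr 1; push_cast; ring
  simp only [Pi.add_apply]
  rw [e, mul_assoc, ← mul_add]
  gcongr
  calc ‖f ξ‖ ^ 2 ≤ (1 / 2 * (‖F₀ ξ‖ + ‖ξ‖⁻¹ * ‖F₁ ξ‖)) ^ 2 := by gcongr; exact hf ξ
    _ ≤ ‖F₀ ξ‖ ^ 2 + ‖ξ‖⁻¹ ^ 2 * ‖F₁ ξ‖ ^ 2 := by
      rw [← mul_pow]
      nlinarith [sq_nonneg (‖F₀ ξ‖ - ‖ξ‖⁻¹ * ‖F₁ ξ‖), sq_nonneg (‖F₀ ξ‖ + ‖ξ‖⁻¹ * ‖F₁ ξ‖)]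

theorem waveDivergenceSet_congr {d : ℕ} (ψ : SchwartzMap ℝ ℝ) {F₀ F₁ G₀ G₁ : Euc d → ℂ}
    (h₀ : F₀ =ᵐ[volume] G₀) (h₁ : F₁ =ᵐ[volume] G₁) :
    waveDivergenceSet d ψ F₀ F₁ = waveDivergenceSet d ψ G₀ G₁ := by
  have h : wavePartial d ψ F₀ F₁ = wavePartial d ψ G₀ G₁ := by
    ext x t N
    refine integral_congr_ae ?_
    filter_upwards [h₀, h₁] with ξ e₀ e₁
    rw [e₀, e₁]
  simp only [waveDivergenceSet, waveSol, h]

end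

theorem stmt3 (d : ℕ) (hd : 2 ≤ d) (s α β C₀ : ℝ)
    (hs0 : 0 < s) (hsd : s < d / 2) (hα0 : 0 < α) (hαd : α ≤ d)
    (hβ : (d : ℝ) - 2 * s < β)
    (hdecay : ∀ ν : Measure (EuclideanSpace ℝ (Fin d)), IsAlphaDimensional d α ν →
      ∀ R : ℝ, 1 < R →
        ∫ ω, ‖fourierMeasure ν (R • ω)‖ ^ 2 ∂(sphereMeasure d)
          ≤ C₀ * (cAlpha d α ν).toReal * (ν univ).toReal * R ^ (-β)) :
    ∀ (ψ : SchwartzMap ℝ ℝ), (∀ y, 0 < ψ y) → ψ 0 = (2 * Real.pi) ^ (-(d : ℝ) / 2) →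
    ∀ F₀ F₁ : EuclideanSpace ℝ (Fin d) → ℂ,
      AEStronglyMeasurable F₀ volume → AEStronglyMeasurable F₁ volume →
      Integrable (fun ξ => ‖ξ‖ ^ (2 * s) * ‖F₀ ξ‖ ^ 2) volume →
      Integrable (fun ξ => ‖ξ‖ ^ (2 * (s - 1)) * ‖F₁ ξ‖ ^ 2) volume →
      dimH (waveDivergenceSet d ψ F₀ F₁) ≤ ENNReal.ofReal α := by
  intro ψ _ _ F₀ F₁ hm₀ hm₁ hF₀ hF₁
  obtain ⟨n, rfl⟩ : ∃ n, d = n + 1 := ⟨d - 1, by omega⟩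
  obtain ⟨G₀, hG₀m, hFG₀⟩ := hm₀
  obtain ⟨G₁, hG₁m, hFG₁⟩ := hm₁
  have hG₀ : Integrable (fun ξ => ‖ξ‖ ^ (2 * s) * ‖G₀ ξ‖ ^ 2) volume :=
    hF₀.congr (by filter_upwards [hFG₀] with ξ e; rw [e])
  have hG₁ : Integrable (fun ξ => ‖ξ‖ ^ (2 * (s - 1)) * ‖G₁ ξ‖ ^ 2) volume :=
    hF₁.congr (by filter_upwards [hFG₁] with ξ e; rw [e])
  have hM₀ := hG₀m.measurable
  have hM₁ := hG₁m.measurable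
  push_cast at hsd hβ
  have hsn : 2 * s < n + 1 := by linarith
  set f : Euc (n + 1) → ℂ :=
    fun ξ => (1 / 2 : ℂ) * (G₀ ξ - Complex.I * ((‖ξ‖⁻¹ : ℝ) : ℂ) * G₁ ξ) with hfdef
  set g : Euc (n + 1) → ℂ :=
    fun ξ => (1 / 2 : ℂ) * (G₀ ξ + Complex.I * ((‖ξ‖⁻¹ : ℝ) : ℂ) * G₁ ξ) with hgdef
  have hf : Measurable f := by fun_prop
  have hg : Measurable g := by fun_prop
  have hnorm : ∀ ξ : Euc (n + 1),
      ‖Complex.I * ((‖ξ‖⁻¹ : ℝ) : ℂ) * G₁ ξ‖ = ‖ξ‖⁻¹ * ‖G₁ ξ‖ := fun ξ => by simp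
  have hfE : energy n s f ≠ ⊤ := energy_ne_top n hG₀ hG₁ fun ξ => by
    rw [hfdef, norm_mul, ← hnorm]
    refine mul_le_mul (by simp) (norm_sub_le _ _) (norm_nonneg _) (by norm_num)
  have hgE : energy n s g ≠ ⊤ := energy_ne_top n hG₀ hG₁ fun ξ => by
    rw [hgdef, norm_mul, ← hnorm]
    refine mul_le_mul (by simp) (norm_add_le _ _) (norm_nonneg _) (by norm_num)
  rw [waveDivergenceSet_congr ψ hFG₀ hFG₁]
  refine (dimH_mono (waveDivergenceSet_subset n hs0 hsn ψ hfdef hgdef hf hg hfE hgE)).trans ?_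
  rw [dimH_union]
  exact max_le (dimH_radialDivergenceSet_le n (by omega) hs0 hsn hβ hα0 hαd hdecay hf hfE)
    (dimH_radialDivergenceSet_le n (by omega) hs0 hsn hβ hα0 hαd hdecay hg hgE)
end
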